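/- arXiv:2111.14699 — 2 statements merged into one kernel-verified Lean document; each statement's English description precedes it below -/
import Mathlib

section
/- There exists a real polynomial u such that the even Schwartz function f(x) = u(x²) e^{−x²/2} satisfies: (i) f(x) ≤ 0 for all x ∈ ℝ; (ii) f̂(√(λ − 1/4)) ≥ 0.673429 for all λ ∈ [1.04, 1.857]; (iii) f̂(√(λ − 1/4)) ≥ 0 for all λ ≥ 1.857; (iv) (1/0.673429) · ( 4 ∫₀^∞ ξ f̂(ξ) tanh(πξ) dξ − (1/√(2π)) ∫_ℝ f(x) cosh(x/2) dx ) ≤ 8.957. -/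
open Real MeasureTheory

/-- The even function `x ↦ u(x²) e^{-x²/2}` associated to a real polynomial `u`. -/
noncomputable def gaussPoly (u : Polynomial ℝ) (x : ℝ) : ℝ :=
  u.eval (x ^ 2) * Real.exp (-x ^ 2 / 2)

/-- The Fourier transform `f̂(ξ) = (1/√(2π)) ∫_ℝ f(x) e^{-iξx} dx` of an even real-valued
function, written in its real form `(1/√(2π)) ∫_ℝ f(x) cos(ξ x) dx`. -/
noncomputable def evenFT (f : ℝ → ℝ) (ξ : ℝ) : ℝ :=
  (1 / Real.sqrt (2 * π)) * ∫ x : ℝ, f x * Real.cos (ξ * x)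

/-! ### Polynomials as coefficient lists -/

/-- The value at `x` of the polynomial with coefficients `p`, constant term first. -/
def listEval : List ℚ → ℝ → ℝ
  | [], _ => 0
  | c :: p, x => c + x * listEval p x

/-- Sum of coefficient lists. -/
def listAdd : List ℚ → List ℚ → List ℚ
  | [], q => q
  | p, [] => p
  | a :: p, b :: q => (a + b) :: listAdd p q

/-- Scalar multiple of a coefficient list. -/
def listSmul (c : ℚ) : List ℚ → List ℚ
  | [] => []
  | a :: p => (c * a) :: listSmul c p

/-- Product of coefficient lists. -/
def listMul : List ℚ → List ℚ → List ℚ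
  | [], _ => []
  | a :: p, q => listAdd (listSmul a q) (0 :: listMul p q)

/-- Coefficients of `s ↦ p (h + s)`. -/
def listShift (h : ℚ) : List ℚ → List ℚ
  | [] => []
  | c :: p => listAdd (c :: listShift h p) (listSmul h (listShift h p))

/-- A lower bound of `p` on `[0, h]`, from Horner's scheme. -/
def hornerLower (h : ℚ) : List ℚ → ℚ
  | [] => 0
  | c :: p => c + h * min 0 (hornerLower h p)

/-- Certifies that `p` is nonnegative on `[0, L]` by walking through `[0, L]` with adaptive
steps, starting with steps of length `h`. -/
def nonnegOn : ℕ → ℚ → ℚ → List ℚ → Bool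
  | 0, _, _, _ => false
  | fuel + 1, L, h, p =>
    if L < 0 then true
    else if 0 ≤ hornerLower h p then nonnegOn fuel (L - h) (2 * h) (listShift h p)
    else nonnegOn fuel L (h / 2) p

theorem listEval_add (p q : List ℚ) (x : ℝ) :
    listEval (listAdd p q) x = listEval p x + listEval q x := by
  fun_induction listAdd p q <;> simp_all [listEval]
  ring

theorem listEval_smul (c : ℚ) (p : List ℚ) (x : ℝ) :
    listEval (listSmul c p) x = c * listEval p x := by
  induction p with
  | nil => simp [listSmul, listEval]
  | cons a p ih => simp only [listSmul, listEval, ih]; push_cast; ring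

theorem listEval_mul (p q : List ℚ) (x : ℝ) :
    listEval (listMul p q) x = listEval p x * listEval q x := by
  induction p with
  | nil => simp [listMul, listEval]
  | cons a p ih =>
    simp only [listMul, listEval, listEval_add, listEval_smul, ih]; push_cast; ring

theorem listEval_shift (h : ℚ) (p : List ℚ) (x : ℝ) :
    listEval (listShift h p) x = listEval p (h + x) := by
  induction p with
  | nil => simp [listShift, listEval]
  | cons a p ih => simp only [listShift, listEval, listEval_add, listEval_smul, ih]; ring

theorem listEval_nonneg {p : List ℚ} (hp : ∀ c ∈ p, 0 ≤ c) {x : ℝ} (hx : 0 ≤ x) :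
    0 ≤ listEval p x := by
  induction p with
  | nil => simp [listEval]
  | cons a p ih =>
    have h1 : (0 : ℝ) ≤ a := by exact_mod_cast hp a (by simp)
    have h2 := ih fun c hc => hp c (by simp [hc])
    simp only [listEval]
    positivity

theorem hornerLower_le {h : ℚ} (p : List ℚ) {x : ℝ} (hx : 0 ≤ x) (hxh : x ≤ h) :
    hornerLower h p ≤ listEval p x := by
  induction p with
  | nil => simp [hornerLower, listEval]
  | cons a p ih =>
    simp only [hornerLower, listEval]
    push_cast
    have h1 : (h : ℝ) * min 0 (hornerLower h p : ℝ) ≤ x * min 0 (hornerLower h p : ℝ) :=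
      mul_le_mul_of_nonpos_right hxh (min_le_left _ _)
    have h2 : x * min 0 (hornerLower h p : ℝ) ≤ x * listEval p x :=
      mul_le_mul_of_nonneg_left ((min_le_right _ _).trans ih) hx
    linarith

theorem listEval_nonneg_of_nonnegOn {fuel : ℕ} {L h : ℚ} {p : List ℚ}
    (hc : nonnegOn fuel L h p = true) {x : ℝ} (hx : 0 ≤ x) (hxL : x ≤ L) :
    0 ≤ listEval p x := by
  induction fuel generalizing L h p x with
  | zero => simp [nonnegOn] at hc
  | succ fuel ih =>
    unfold nonnegOn at hc
    split_ifs at hc with h1 h2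
    · have : (L : ℝ) < 0 := by exact_mod_cast h1
      linarith
    · rcases le_total x h with hxh | hxh
      · have h3 : (0 : ℝ) ≤ hornerLower h p := by exact_mod_cast h2
        exact h3.trans (hornerLower_le p hx hxh)
      · have := ih hc (x := x - h) (by linarith) (by push_cast; linarith)
        rwa [listEval_shift, add_sub_cancel] at this
    · exact ih hc hx hxL

theorem listEval_nonneg_of_nonnegOn_shift {fuel : ℕ} {a L h : ℚ} {p : List ℚ}
    (hc : nonnegOn fuel L h (listShift a p) = true) {x : ℝ} (hx : a ≤ x) (hxL : x ≤ a + L) :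
    0 ≤ listEval p x := by
  have := listEval_nonneg_of_nonnegOn hc (x := x - a) (by linarith) (by linarith)
  rwa [listEval_shift, add_sub_cancel] at this

theorem listEval_nonneg_of_shift {a : ℚ} {p : List ℚ} (hp : ∀ c ∈ listShift a p, 0 ≤ c) {x : ℝ}
    (hx : a ≤ x) : 0 ≤ listEval p x := by
  have := listEval_nonneg hp (x := x - a) (by linarith)
  rwa [listEval_shift, add_sub_cancel] at this

theorem continuous_listEval (p : List ℚ) : Continuous (listEval p) := by
  induction p with
  | nil => exact continuous_const
  | cons a p ih => exact continuous_const.add (continuous_id.mul ih)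

/-- The coefficient list `p` as an honest real polynomial. -/
noncomputable def listPoly : List ℚ → Polynomial ℝ
  | [] => 0
  | c :: p => Polynomial.C (c : ℝ) + Polynomial.X * listPoly p

theorem eval_listPoly (p : List ℚ) (x : ℝ) : (listPoly p).eval x = listEval p x := by
  induction p with
  | nil => simp [listPoly, listEval]
  | cons a p ih => simp [listPoly, listEval, ih]

/-! ### Gaussian moments -/

/-- `gaussMoment k` is the polynomial `r` for which `x ↦ x ^ (2k) e^{-x²/2}` has Fourier transform
`ξ ↦ r(ξ²) e^{-ξ²/2}`. -/
def gaussMoment : ℕ → List ℚ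
  | 0 => [1]
  | 1 => [1, -1]
  | k + 2 => listAdd (listMul [4 * k + 5, -1] (gaussMoment (k + 1)))
      (listSmul (-((2 * k + 2) * (2 * k + 1))) (gaussMoment k))

/-- `gaussTransform k p` is the polynomial `v` for which `x ↦ x ^ (2k) p(x²) e^{-x²/2}` has Fourier
transform `ξ ↦ v(ξ²) e^{-ξ²/2}`. -/
def gaussTransform : ℕ → List ℚ → List ℚ
  | _, [] => []
  | k, c :: p => listAdd (listSmul c (gaussMoment k)) (gaussTransform (k + 1) p)

/-- `gaussHalfMoment k p` is `∫ ξ ^ (2k+1) p(ξ²) e^{-ξ²/2} dξ` over `(0, ∞)`. -/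
def gaussHalfMoment : ℕ → List ℚ → ℚ
  | _, [] => 0
  | k, c :: p => c * (2 ^ k * k.factorial) + gaussHalfMoment (k + 1) p

theorem integrable_pow_mul_exp_mul_gauss (n : ℕ) (a : ℝ) :
    Integrable fun x : ℝ => x ^ n * Real.exp (a * x - x ^ 2 / 2) := by
  have h0 : Integrable fun x : ℝ => x ^ n * Real.exp (-(1 / 4) * x ^ 2) := by
    have := integrable_rpow_mul_exp_neg_mul_sq (b := 1 / 4) (by norm_num) (s := n)
      (by have : (0 : ℝ) ≤ n := n.cast_nonneg
          linarith)
    simpa only [Real.rpow_natCast] using this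
  refine (h0.const_mul (Real.exp (a ^ 2))).mono (by fun_prop) (Filter.Eventually.of_forall fun x => ?_)
  rw [mul_left_comm, ← Real.exp_add, norm_mul, norm_mul]
  refine mul_le_mul_of_nonneg_left ?_ (norm_nonneg _)
  rw [Real.norm_eq_abs, Real.norm_eq_abs, Real.abs_exp, Real.abs_exp]
  exact Real.exp_le_exp.2 (by nlinarith [sq_nonneg (a - x / 2)])

theorem integrable_pow_mul_cexp (n : ℕ) (z : ℂ) :
    Integrable fun x : ℝ => (x : ℂ) ^ n * Complex.exp (z * x - (x : ℂ) ^ 2 / 2) := by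
  have hc : Continuous fun x : ℝ => (x : ℂ) ^ n * Complex.exp (z * x - (x : ℂ) ^ 2 / 2) := by
    fun_prop
  refine (integrable_norm_iff hc.aestronglyMeasurable).1 ?_
  refine (integrable_pow_mul_exp_mul_gauss n z.re).norm.congr (Filter.Eventually.of_forall fun x => ?_)
  have : (z * x - (x : ℂ) ^ 2 / 2).re = z.re * x - x ^ 2 / 2 := by
    simp [← Complex.ofReal_pow]
  simp [Complex.norm_exp, this]

/-- The moments of `e^{zx - x²/2}`. -/
noncomputable def expMoment (z : ℂ) (n : ℕ) : ℂ :=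
  ∫ x : ℝ, (x : ℂ) ^ n * Complex.exp (z * x - (x : ℂ) ^ 2 / 2)

theorem expMoment_zero (z : ℂ) :
    expMoment z 0 = (Real.sqrt (2 * π) : ℂ) * Complex.exp (z ^ 2 / 2) := by
  have h := integral_cexp_quadratic (b := -1 / 2) (by norm_num) z 0
  have h1 : ((π : ℂ) / -(-1 / 2)) ^ (1 / 2 : ℂ) = (Real.sqrt (2 * π) : ℂ) := by
    rw [Real.sqrt_eq_rpow, Complex.ofReal_cpow (by positivity)]
    push_cast
    congr 1
    ring
  rw [h1] at h
  unfold expMoment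
  convert! h using 2
  · ext x
    rw [pow_zero, one_mul]
    congr 1
    ring
  · congr 1
    ring

theorem expMoment_succ (z : ℂ) (n : ℕ) :
    expMoment z (n + 1) = z * expMoment z n + n * expMoment z (n - 1) := by
  have hd : ∀ x : ℝ, HasDerivAt
      (fun x : ℝ => (x : ℂ) ^ n * Complex.exp (z * x - (x : ℂ) ^ 2 / 2))
      (n * ((x : ℂ) ^ (n - 1) * Complex.exp (z * x - (x : ℂ) ^ 2 / 2))
        + z * ((x : ℂ) ^ n * Complex.exp (z * x - (x : ℂ) ^ 2 / 2))
        - (x : ℂ) ^ (n + 1) * Complex.exp (z * x - (x : ℂ) ^ 2 / 2)) x := by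
    intro x
    have h1 : HasDerivAt (fun y : ℂ => y ^ n * Complex.exp (z * y - y ^ 2 / 2)) _ (x : ℂ) :=
      (hasDerivAt_pow n (x : ℂ)).mul
        ((((hasDerivAt_id (x : ℂ)).const_mul z).sub ((hasDerivAt_pow 2 (x : ℂ)).div_const 2)).cexp)
    refine h1.comp_ofReal.congr_deriv ?_
    simp
    ring
  have hi := integrable_pow_mul_cexp (z := z)
  have h12 : Integrable fun x : ℝ => n * ((x : ℂ) ^ (n - 1) * Complex.exp (z * x - (x : ℂ) ^ 2 / 2))
      + z * ((x : ℂ) ^ n * Complex.exp (z * x - (x : ℂ) ^ 2 / 2)) :=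
    ((hi (n - 1)).const_mul (n : ℂ)).add ((hi n).const_mul z)
  have := integral_eq_zero_of_hasDerivAt_of_integrable hd (h12.sub (hi (n + 1))) (hi n)
  rw [integral_sub h12 (hi (n + 1)), integral_add ((hi (n - 1)).const_mul (n : ℂ))
    ((hi n).const_mul z), integral_const_mul, integral_const_mul] at this
  unfold expMoment
  linear_combination -this

theorem expMoment_add_four (z : ℂ) (n : ℕ) :
    expMoment z (n + 4) = (z ^ 2 + (2 * n + 5)) * expMoment z (n + 2)
      - (n + 2) * (n + 1) * expMoment z n := by
  have h1 := expMoment_succ z (n + 3)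
  have h2 := expMoment_succ z (n + 2)
  have h3 := expMoment_succ z (n + 1)
  simp only [Nat.add_sub_cancel] at h1 h2 h3
  push_cast at h1 h2 h3
  linear_combination h1 + z * h2 - (n + 2) * h3

theorem expMoment_even {z : ℂ} {t : ℝ} (hz : z ^ 2 = -t) (k : ℕ) :
    expMoment z (2 * k)
      = ((Real.sqrt (2 * π) * Real.exp (-t / 2) * listEval (gaussMoment k) t : ℝ) : ℂ) := by
  have h0 : expMoment z 0 = ((Real.sqrt (2 * π) * Real.exp (-t / 2) : ℝ) : ℂ) := by
    rw [expMoment_zero, hz]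
    push_cast
    rfl
  induction k using Nat.strong_induction_on with
  | _ k ih =>
    match k with
    | 0 => simp [h0, gaussMoment, listEval]
    | 1 =>
      have h1 := expMoment_succ z 0
      have h2 := expMoment_succ z 1
      simp only [Nat.cast_zero, zero_mul, add_zero, zero_add, Nat.cast_one, one_mul, Nat.sub_self,
        one_add_one_eq_two] at h1 h2
      have : expMoment z (2 * 1) = (1 - t) * expMoment z 0 := by
        rw [mul_one, h2, h1]
        linear_combination expMoment z 0 * hz
      rw [this, h0]
      simp only [gaussMoment, listEval]
      push_cast
      ring
    | k + 2 =>
      have h := expMoment_add_four z (2 * k)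
      have e1 := ih k (by omega)
      have e2 := ih (k + 1) (by omega)
      rw [mul_add, mul_one] at e2
      rw [show 2 * (k + 2) = 2 * k + 4 by ring, h, e1, e2, hz]
      simp only [gaussMoment, listEval_add, listEval_mul, listEval_smul, listEval]
      push_cast
      ring

theorem expMoment_even_neg (z : ℂ) (k : ℕ) : expMoment (-z) (2 * k) = expMoment z (2 * k) := by
  unfold expMoment
  rw [← integral_neg_eq_self]
  refine integral_congr_ae (Filter.Eventually.of_forall fun x => ?_)
  simp [(even_two_mul k).neg_pow]

theorem integrable_pow_mul_cosh (n : ℕ) (z : ℂ) :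
    Integrable fun x : ℝ => ((x ^ n * Real.exp (-x ^ 2 / 2) : ℝ) : ℂ) * Complex.cosh (z * x) := by
  have := ((integrable_pow_mul_cexp n z).add (integrable_pow_mul_cexp n (-z))).div_const 2
  refine this.congr (Filter.Eventually.of_forall fun x => ?_)
  simp only [Pi.add_apply, Complex.cosh]
  push_cast
  rw [sub_eq_add_neg, sub_eq_add_neg, Complex.exp_add, Complex.exp_add, neg_mul, neg_div]
  ring

theorem integral_pow_mul_cosh {z : ℂ} {t : ℝ} (hz : z ^ 2 = -t) (k : ℕ) :
    ∫ x : ℝ, ((x ^ (2 * k) * Real.exp (-x ^ 2 / 2) : ℝ) : ℂ) * Complex.cosh (z * x)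
      = ((Real.sqrt (2 * π) * Real.exp (-t / 2) * listEval (gaussMoment k) t : ℝ) : ℂ) := by
  have h : ∀ x : ℝ, ((x ^ (2 * k) * Real.exp (-x ^ 2 / 2) : ℝ) : ℂ) * Complex.cosh (z * x)
      = ((x : ℂ) ^ (2 * k) * Complex.exp (z * x - (x : ℂ) ^ 2 / 2)
        + (x : ℂ) ^ (2 * k) * Complex.exp (-z * x - (x : ℂ) ^ 2 / 2)) / 2 := by
    intro x
    simp only [Complex.cosh]
    push_cast
    rw [sub_eq_add_neg, sub_eq_add_neg, Complex.exp_add, Complex.exp_add, neg_mul, neg_div]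
    ring
  simp_rw [h]
  rw [integral_div, integral_add (integrable_pow_mul_cexp _ _) (integrable_pow_mul_cexp _ _)]
  change (expMoment z (2 * k) + expMoment (-z) (2 * k)) / 2 = _
  rw [expMoment_even_neg, expMoment_even hz]
  ring

theorem integrable_listEval_mul_cosh (z : ℂ) (p : List ℚ) (k : ℕ) :
    Integrable fun x : ℝ => ((x ^ (2 * k) * listEval p (x ^ 2) * Real.exp (-x ^ 2 / 2) : ℝ) : ℂ)
      * Complex.cosh (z * x) := by
  induction p generalizing k with
  | nil => simp [listEval]
  | cons c p ih =>
    refine (((integrable_pow_mul_cosh (2 * k) z).const_mul (c : ℂ)).add (ih (k + 1))).congr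
      (Filter.Eventually.of_forall fun x => ?_)
    simp only [Pi.add_apply, listEval]
    push_cast
    ring

theorem integral_listEval_mul_cosh {z : ℂ} {t : ℝ} (hz : z ^ 2 = -t) (p : List ℚ) (k : ℕ) :
    ∫ x : ℝ, ((x ^ (2 * k) * listEval p (x ^ 2) * Real.exp (-x ^ 2 / 2) : ℝ) : ℂ)
        * Complex.cosh (z * x)
      = ((Real.sqrt (2 * π) * Real.exp (-t / 2) * listEval (gaussTransform k p) t : ℝ) : ℂ) := by
  induction p generalizing k with
  | nil => simp [listEval, gaussTransform]
  | cons c p ih =>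
    have h : ∀ x : ℝ, ((x ^ (2 * k) * listEval (c :: p) (x ^ 2) * Real.exp (-x ^ 2 / 2) : ℝ) : ℂ)
        * Complex.cosh (z * x)
        = c * (((x ^ (2 * k) * Real.exp (-x ^ 2 / 2) : ℝ) : ℂ) * Complex.cosh (z * x))
          + ((x ^ (2 * (k + 1)) * listEval p (x ^ 2) * Real.exp (-x ^ 2 / 2) : ℝ) : ℂ)
            * Complex.cosh (z * x) := by
      intro x
      simp only [listEval]
      push_cast
      ring
    simp_rw [h]
    rw [integral_add ((integrable_pow_mul_cosh _ _).const_mul _)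
      (integrable_listEval_mul_cosh _ _ _), integral_const_mul, integral_pow_mul_cosh hz, ih]
    simp only [gaussTransform, listEval_add, listEval_smul]
    push_cast
    ring

theorem gaussPoly_listPoly (p : List ℚ) (x : ℝ) :
    gaussPoly (listPoly p) x = listEval p (x ^ 2) * Real.exp (-x ^ 2 / 2) := by
  rw [gaussPoly, eval_listPoly]

theorem evenFT_gaussPoly (p : List ℚ) (ξ : ℝ) :
    evenFT (gaussPoly (listPoly p)) ξ
      = listEval (gaussTransform 0 p) (ξ ^ 2) * Real.exp (-ξ ^ 2 / 2) := by
  have h := integral_listEval_mul_cosh (z := ξ * Complex.I) (t := ξ ^ 2)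
    (by rw [mul_pow, Complex.I_sq]; push_cast; ring) p 0
  have h2 : ∫ x : ℝ, gaussPoly (listPoly p) x * Real.cos (ξ * x)
      = Real.sqrt (2 * π) * Real.exp (-ξ ^ 2 / 2) * listEval (gaussTransform 0 p) (ξ ^ 2) := by
    rw [← Complex.ofReal_inj, ← h, ← integral_complex_ofReal]
    refine integral_congr_ae (Filter.Eventually.of_forall fun x => ?_)
    simp only [gaussPoly_listPoly]
    rw [mul_right_comm (ξ : ℂ), Complex.cosh_mul_I]
    push_cast
    ring
  have : Real.sqrt (2 * π) ≠ 0 := by positivity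
  rw [evenFT, h2]
  field_simp

theorem integral_gaussPoly_mul_cosh (p : List ℚ) :
    (1 / Real.sqrt (2 * π)) * ∫ x : ℝ, gaussPoly (listPoly p) x * Real.cosh (x / 2)
      = listEval (gaussTransform 0 p) (-1 / 4) * Real.exp (1 / 8) := by
  have h := integral_listEval_mul_cosh (z := 1 / 2) (t := -1 / 4)
    (by push_cast; norm_num) p 0
  have h2 : ∫ x : ℝ, gaussPoly (listPoly p) x * Real.cosh (x / 2)
      = Real.sqrt (2 * π) * Real.exp (1 / 8) * listEval (gaussTransform 0 p) (-1 / 4) := by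
    rw [show (1 / 8 : ℝ) = -(-1 / 4) / 2 by norm_num, ← Complex.ofReal_inj, ← h,
      ← integral_complex_ofReal]
    refine integral_congr_ae (Filter.Eventually.of_forall fun x => ?_)
    simp only [gaussPoly_listPoly]
    push_cast
    rw [one_div_mul_eq_div]
    ring
  have : Real.sqrt (2 * π) ≠ 0 := by positivity
  rw [h2]
  field_simp

/-! ### Integrals over the half line -/

theorem integrableOn_pow_mul_exp_neg_mul (n : ℕ) {r : ℝ} (hr : 0 < r) :
    IntegrableOn (fun ξ : ℝ => ξ ^ n * Real.exp (-r * ξ)) (Set.Ioi 0) := by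
  have := integrableOn_rpow_mul_exp_neg_mul_rpow (p := 1) (s := n) (b := r)
    (by have : (0 : ℝ) ≤ n := n.cast_nonneg
        linarith) one_pos hr
  simpa only [Real.rpow_natCast, Real.rpow_one] using this

theorem integral_pow_mul_exp_neg_mul (n : ℕ) {r : ℝ} (hr : 0 < r) :
    ∫ ξ in Set.Ioi (0 : ℝ), ξ ^ n * Real.exp (-r * ξ) = n.factorial / r ^ (n + 1) := by
  have := integral_rpow_mul_exp_neg_mul_rpow (p := 1) (q := n) (b := r) one_pos
    (by have : (0 : ℝ) ≤ n := n.cast_nonneg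
        linarith) hr
  simp only [Real.rpow_natCast, Real.rpow_one, div_one, Real.Gamma_nat_eq_factorial] at this
  rw [this, Real.rpow_neg hr.le, ← Nat.cast_add_one, Real.rpow_natCast]
  ring

theorem integrableOn_pow_mul_gauss (k : ℕ) :
    IntegrableOn (fun ξ : ℝ => ξ ^ k * Real.exp (-ξ ^ 2 / 2)) (Set.Ioi 0) := by
  have := (integrable_pow_mul_exp_mul_gauss k 0).integrableOn (s := Set.Ioi 0)
  simpa only [zero_mul, zero_sub, neg_div] using this

theorem integral_odd_pow_mul_gauss (k : ℕ) :
    ∫ ξ in Set.Ioi (0 : ℝ), ξ ^ (2 * k + 1) * Real.exp (-ξ ^ 2 / 2) = 2 ^ k * k.factorial := by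
  have := integral_rpow_mul_exp_neg_mul_rpow (p := 2) (q := (2 * k + 1 : ℕ)) (b := 1 / 2) two_pos
    (by have : (0 : ℝ) ≤ (2 * k + 1 : ℕ) := Nat.cast_nonneg _
        linarith) (by norm_num)
  have e : (((2 * k + 1 : ℕ) : ℝ) + 1) / 2 = k + 1 := by push_cast; ring
  rw [neg_div, e, Real.Gamma_nat_eq_factorial, Real.rpow_neg (by norm_num), ← Nat.cast_add_one,
    Real.rpow_natCast] at this
  simp only [Real.rpow_natCast, Real.rpow_two] at this
  have h : ∀ ξ : ℝ, -ξ ^ 2 / 2 = -(1 / 2) * ξ ^ 2 := fun ξ => by ring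
  simp_rw [h]
  rw [this, one_div, inv_pow, inv_inv, pow_succ]
  ring

theorem integrableOn_listEval_mul_gauss (p : List ℚ) (k : ℕ) :
    IntegrableOn (fun ξ : ℝ => ξ ^ (2 * k + 1) * listEval p (ξ ^ 2) * Real.exp (-ξ ^ 2 / 2))
      (Set.Ioi 0) := by
  induction p generalizing k with
  | nil => simp [listEval]
  | cons c p ih =>
    refine (((integrableOn_pow_mul_gauss (2 * k + 1)).const_mul (c : ℝ)).add (ih (k + 1))).congr
      (Filter.Eventually.of_forall fun x => ?_)
    simp only [Pi.add_apply, listEval]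
    ring

theorem integral_listEval_mul_gauss (p : List ℚ) (k : ℕ) :
    ∫ ξ in Set.Ioi (0 : ℝ), ξ ^ (2 * k + 1) * listEval p (ξ ^ 2) * Real.exp (-ξ ^ 2 / 2)
      = gaussHalfMoment k p := by
  induction p generalizing k with
  | nil => simp [listEval, gaussHalfMoment]
  | cons c p ih =>
    have h : ∀ ξ : ℝ, ξ ^ (2 * k + 1) * listEval (c :: p) (ξ ^ 2) * Real.exp (-ξ ^ 2 / 2)
        = c * (ξ ^ (2 * k + 1) * Real.exp (-ξ ^ 2 / 2))
          + ξ ^ (2 * (k + 1) + 1) * listEval p (ξ ^ 2) * Real.exp (-ξ ^ 2 / 2) := by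
      intro ξ
      simp only [listEval]
      ring
    simp_rw [h]
    rw [integral_add ((integrableOn_pow_mul_gauss _).const_mul _)
      (integrableOn_listEval_mul_gauss p (k + 1)), integral_const_mul, integral_odd_pow_mul_gauss,
      ih]
    simp only [gaussHalfMoment]
    push_cast
    ring

/-- A truncated expansion in powers of `e^{-2πξ}`. -/
noncomputable def expSum (c₁ c₂ c₃ c₄ ξ : ℝ) : ℝ :=
  c₁ * Real.exp (-(2 * π) * ξ) + c₂ * Real.exp (-(2 * π * 2) * ξ)
    + c₃ * Real.exp (-(2 * π * 3) * ξ) + c₄ * Real.exp (-(2 * π * 4) * ξ)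

theorem hasIntegral_pow_mul_expSum (n : ℕ) (c₁ c₂ c₃ c₄ : ℝ) :
    IntegrableOn (fun ξ : ℝ => ξ ^ n * expSum c₁ c₂ c₃ c₄ ξ) (Set.Ioi 0) ∧
      ∫ ξ in Set.Ioi (0 : ℝ), ξ ^ n * expSum c₁ c₂ c₃ c₄ ξ
        = n.factorial / (2 * π) ^ (n + 1)
          * (c₁ + c₂ / 2 ^ (n + 1) + c₃ / 3 ^ (n + 1) + c₄ / 4 ^ (n + 1)) := by
  have hπ := Real.pi_pos
  have i : ∀ j c : ℝ, 0 < j → IntegrableOn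
      (fun ξ : ℝ => c * (ξ ^ n * Real.exp (-(2 * π * j) * ξ))) (Set.Ioi 0) := fun j c hj =>
    (integrableOn_pow_mul_exp_neg_mul n (r := 2 * π * j) (by positivity)).const_mul c
  have e : (fun ξ : ℝ => ξ ^ n * expSum c₁ c₂ c₃ c₄ ξ) = fun ξ =>
      c₁ * (ξ ^ n * Real.exp (-(2 * π * 1) * ξ)) + c₂ * (ξ ^ n * Real.exp (-(2 * π * 2) * ξ))
        + c₃ * (ξ ^ n * Real.exp (-(2 * π * 3) * ξ))
        + c₄ * (ξ ^ n * Real.exp (-(2 * π * 4) * ξ)) := by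
    ext ξ
    rw [expSum, mul_one]
    ring
  have i1 := i 1 c₁ (by norm_num)
  have i2 := i 2 c₂ (by norm_num)
  have i3 := i 3 c₃ (by norm_num)
  have i4 := i 4 c₄ (by norm_num)
  rw [e]
  have i12 : IntegrableOn (fun ξ : ℝ => c₁ * (ξ ^ n * Real.exp (-(2 * π * 1) * ξ))
      + c₂ * (ξ ^ n * Real.exp (-(2 * π * 2) * ξ))) (Set.Ioi 0) := i1.add i2
  have i123 : IntegrableOn (fun ξ : ℝ => c₁ * (ξ ^ n * Real.exp (-(2 * π * 1) * ξ))
      + c₂ * (ξ ^ n * Real.exp (-(2 * π * 2) * ξ))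
      + c₃ * (ξ ^ n * Real.exp (-(2 * π * 3) * ξ))) (Set.Ioi 0) := i12.add i3
  refine ⟨i123.add i4, ?_⟩
  rw [integral_add i123 i4, integral_add i12 i3, integral_add i1 i2]
  simp only [integral_const_mul]
  rw [integral_pow_mul_exp_neg_mul n (by positivity), integral_pow_mul_exp_neg_mul n (by positivity),
    integral_pow_mul_exp_neg_mul n (by positivity), integral_pow_mul_exp_neg_mul n (by positivity)]
  simp only [mul_pow]
  field_simp
  ring

/-! ### Exponential estimates -/

theorem exp_neg_taylor_alternating (n : ℕ) {s : ℝ} (hs : 0 ≤ s) :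
    0 ≤ (-1) ^ n * (∑ k ∈ Finset.range (n + 1), (-s) ^ k / k.factorial - Real.exp (-s)) := by
  induction n generalizing s with
  | zero => simpa using hs
  | succ n ih =>
    set G : ℝ → ℝ := fun y =>
      (-1) ^ (n + 1) * (∑ k ∈ Finset.range (n + 1 + 1), (-y) ^ k / k.factorial - Real.exp (-y))
    have hd : ∀ y : ℝ, HasDerivAt G
        ((-1) ^ n * (∑ k ∈ Finset.range (n + 1), (-y) ^ k / k.factorial - Real.exp (-y))) y := by
      intro y
      have h1 : HasDerivAt (fun y : ℝ => ∑ k ∈ Finset.range (n + 1 + 1), (-y) ^ k / k.factorial)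
          (∑ k ∈ Finset.range (n + 1 + 1), (k * (-y) ^ (k - 1) * (-1)) / k.factorial) y :=
        HasDerivAt.fun_sum fun k _ => (((hasDerivAt_id y).neg).pow k).div_const _
      have h2 := (h1.sub (hasDerivAt_id y).neg.exp).const_mul ((-1 : ℝ) ^ (n + 1))
      refine h2.congr_deriv ?_
      rw [Finset.sum_range_succ']
      have h3 : ∀ k ∈ Finset.range (n + 1), ((k + 1 : ℕ) * (-y) ^ (k + 1 - 1) * (-1))
          / ((k + 1).factorial : ℝ) = -((-y) ^ k / k.factorial) := by
        intro k _
        rw [Nat.factorial_succ, Nat.add_sub_cancel]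
        push_cast
        have : (k.factorial : ℝ) ≠ 0 := by positivity
        field_simp
      rw [Finset.sum_congr rfl h3, Finset.sum_neg_distrib]
      simp
      ring
    have hm : MonotoneOn G (Set.Ici 0) := by
      refine monotoneOn_of_deriv_nonneg (convex_Ici 0)
        (fun y _ => (hd y).continuousAt.continuousWithinAt)
        (fun y _ => (hd y).differentiableAt.differentiableWithinAt) fun y hy => ?_
      rw [(hd y).deriv]
      rw [interior_Ici] at hy
      exact ih (le_of_lt hy)
    have h0 : G 0 = 0 := by
      simp [G, Finset.sum_range_succ']
    have := hm (Set.mem_Ici.2 le_rfl) (Set.mem_Ici.2 hs) hs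
    rwa [h0] at this

/-- Taylor coefficients of `t ↦ e^{-t/2}` up to degree 7. -/
def expNegHalfLower : List ℚ :=
  [1, -1 / 2, 1 / 8, -1 / 48, 1 / 384, -1 / 3840, 1 / 46080, -1 / 645120]

/-- Taylor coefficients of `t ↦ e^{-t/2}` up to degree 6. -/
def expNegHalfUpper : List ℚ := [1, -1 / 2, 1 / 8, -1 / 48, 1 / 384, -1 / 3840, 1 / 46080]

theorem expNegHalfLower_le {t : ℝ} (ht : 0 ≤ t) :
    listEval expNegHalfLower t ≤ Real.exp (-t / 2) := by
  have h := exp_neg_taylor_alternating 7 (s := t / 2) (by linarith)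
  simp only [Finset.sum_range_succ, Finset.sum_range_zero, Nat.factorial] at h
  simp only [expNegHalfLower, listEval]
  rw [show -t / 2 = -(t / 2) by ring]
  push_cast at h ⊢
  linarith

theorem le_expNegHalfUpper {t : ℝ} (ht : 0 ≤ t) :
    Real.exp (-t / 2) ≤ listEval expNegHalfUpper t := by
  have h := exp_neg_taylor_alternating 6 (s := t / 2) (by linarith)
  simp only [Finset.sum_range_succ, Finset.sum_range_zero, Nat.factorial] at h
  simp only [expNegHalfUpper, listEval]
  rw [show -t / 2 = -(t / 2) by ring]
  push_cast at h ⊢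
  linarith

theorem one_sub_tanh_eq (ξ : ℝ) :
    1 - Real.tanh (π * ξ)
      = 2 * Real.exp (-(2 * π) * ξ) / (1 + Real.exp (-(2 * π) * ξ)) := by
  have h : Real.exp (-(2 * π) * ξ) = Real.exp (-(π * ξ)) * Real.exp (-(π * ξ)) := by
    rw [← Real.exp_add]
    congr 1
    ring
  have h1 : Real.exp (π * ξ) * Real.exp (-(π * ξ)) = 1 := by
    rw [← Real.exp_add, add_neg_cancel, Real.exp_zero]
  have hp := Real.exp_pos (π * ξ)
  have hn := Real.exp_pos (-(π * ξ))
  rw [Real.tanh_eq_sinh_div_cosh, Real.sinh_eq, Real.cosh_eq, h]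
  field_simp
  linear_combination (-2) * Real.exp (-(π * ξ)) * h1

theorem expSum_eq (c₁ c₂ c₃ c₄ ξ : ℝ) :
    expSum c₁ c₂ c₃ c₄ ξ = c₁ * Real.exp (-(2 * π) * ξ) + c₂ * Real.exp (-(2 * π) * ξ) ^ 2
      + c₃ * Real.exp (-(2 * π) * ξ) ^ 3 + c₄ * Real.exp (-(2 * π) * ξ) ^ 4 := by
  simp only [expSum, ← Real.exp_nat_mul]
  push_cast
  ring_nf

theorem one_sub_tanh_le {ξ : ℝ} (hξ : 0 ≤ ξ) :
    1 - Real.tanh (π * ξ) ≤ expSum 2 (-2) 2 (-1) ξ := by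
  rw [one_sub_tanh_eq, expSum_eq]
  have h1 : Real.exp (-(2 * π) * ξ) ≤ 1 := by
    rw [Real.exp_le_one_iff]
    nlinarith [mul_nonneg Real.pi_pos.le hξ]
  have h0 := Real.exp_pos (-(2 * π) * ξ)
  generalize Real.exp (-(2 * π) * ξ) = x at *
  rw [div_le_iff₀ (by linarith)]
  nlinarith [mul_nonneg (pow_pos h0 4).le (sub_nonneg.2 h1)]

theorem le_one_sub_tanh {ξ : ℝ} (hξ : 0 ≤ ξ) :
    expSum 2 (-2) 1 0 ξ ≤ 1 - Real.tanh (π * ξ) := by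
  rw [one_sub_tanh_eq, expSum_eq]
  have h1 : Real.exp (-(2 * π) * ξ) ≤ 1 := by
    rw [Real.exp_le_one_iff]
    nlinarith [mul_nonneg Real.pi_pos.le hξ]
  have h0 := Real.exp_pos (-(2 * π) * ξ)
  generalize Real.exp (-(2 * π) * ξ) = x at *
  rw [le_div_iff₀ (by linarith)]
  nlinarith [mul_nonneg (pow_pos h0 3).le (sub_nonneg.2 h1)]

/-! ### The test function -/

/-- The coefficients of the test polynomial `u`. -/
def testCoeffs : List ℚ :=
  [-0.00010117, -0.36013, -0.072048, -0.05118, 0.014039, -0.0049459, 0.00085301, -0.00009804,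
    0.0000067771, -0.00000028225, 0.000000006194, -0.000000000053327]

/-- The polynomial `v` with `f̂(ξ) = v(ξ²) e^{-ξ²/2}`. -/
def testCoeffsFT : List ℚ := gaussTransform 0 testCoeffs

/-- A quadratic minorant of `t ↦ v(t) e^{-t/2}` on `[0, ∞)`, where `v` is `testCoeffsFT`. -/
def minorant : List ℚ := [-1.594, 5.468, -3.434]

theorem testCoeffs_nonpos {t : ℝ} (ht : 0 ≤ t) : listEval testCoeffs t ≤ 0 := by
  have h : 0 ≤ listEval (listSmul (-1) testCoeffs) t := by
    rcases le_total t 40 with h40 | h40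
    · exact listEval_nonneg_of_nonnegOn (fuel := 100) (L := 40) (h := 1 / 8) (by decide +kernel) ht
        (by exact_mod_cast h40)
    · exact listEval_nonneg_of_shift (a := 40) (by decide +kernel) (by exact_mod_cast h40)
  rw [listEval_smul] at h
  push_cast at h
  linarith

theorem testCoeffsFT_nonneg {t : ℝ} (ht : 1.607 ≤ t) : 0 ≤ listEval testCoeffsFT t := by
  rcases le_total t 40 with h40 | h40
  · exact listEval_nonneg_of_nonnegOn_shift (fuel := 100) (a := 1.607) (L := 40) (h := 1 / 8)
      (by decide +kernel) (by push_cast; linarith) (by push_cast; linarith)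
  · exact listEval_nonneg_of_shift (a := 40) (by decide +kernel) (by exact_mod_cast h40)

theorem testCoeffsFT_lower {t : ℝ} (ht : 0.79 ≤ t) (ht' : t ≤ 1.607) :
    0.673429 ≤ listEval testCoeffsFT t * Real.exp (-t / 2) := by
  have h : 0 ≤ listEval (listAdd (listMul testCoeffsFT expNegHalfLower) [-0.673429]) t :=
    listEval_nonneg_of_nonnegOn_shift (fuel := 100) (a := 0.79) (L := 0.817) (h := 1 / 8)
      (by decide +kernel) (by push_cast; linarith) (by push_cast; linarith)
  have hv : 0 ≤ listEval testCoeffsFT t :=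
    listEval_nonneg_of_nonnegOn_shift (fuel := 100) (a := 0.79) (L := 0.817) (h := 1 / 8)
      (by decide +kernel) (by push_cast; linarith) (by push_cast; linarith)
  have := mul_le_mul_of_nonneg_left (expNegHalfLower_le (t := t) (by linarith)) hv
  rw [listEval_add, listEval_mul] at h
  simp only [listEval] at h
  push_cast at h
  linarith

theorem minorant_le {t : ℝ} (ht : 0 ≤ t) :
    listEval minorant t ≤ listEval testCoeffsFT t * Real.exp (-t / 2) := by
  rcases le_total t 1.607 with h1 | h1
  · have hl : 0 ≤ listEval (listAdd (listMul testCoeffsFT expNegHalfLower)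
        (listSmul (-1) minorant)) t :=
      listEval_nonneg_of_nonnegOn (fuel := 100) (L := 1.607) (h := 1 / 8) (by decide +kernel) ht
        (by push_cast; linarith)
    have hu : 0 ≤ listEval (listAdd (listMul testCoeffsFT expNegHalfUpper)
        (listSmul (-1) minorant)) t :=
      listEval_nonneg_of_nonnegOn (fuel := 100) (L := 1.607) (h := 1 / 8) (by decide +kernel) ht
        (by push_cast; linarith)
    rw [listEval_add, listEval_mul, listEval_smul] at hl hu
    push_cast at hl hu
    rcases le_total 0 (listEval testCoeffsFT t) with hv | hv
    · have := mul_le_mul_of_nonneg_left (expNegHalfLower_le ht) hv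
      linarith
    · have := mul_le_mul_of_nonpos_left (le_expNegHalfUpper ht) hv
      linarith
  · have hm : listEval minorant t ≤ 0 := by
      simp only [minorant, listEval]
      push_cast
      nlinarith
    exact hm.trans (mul_nonneg (testCoeffsFT_nonneg h1) (Real.exp_pos _).le)

theorem neg_le_testCoeffsFT : -3.1032 ≤ listEval testCoeffsFT (-1 / 4) := by
  have h : 0 ≤ listEval (listAdd testCoeffsFT [3.1032]) (-1 / 4) :=
    listEval_nonneg_of_nonnegOn_shift (fuel := 100) (a := -1 / 4) (L := 0) (h := 1)
      (by decide +kernel) (by push_cast; linarith) (by push_cast; linarith)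
  rw [listEval_add] at h
  simp only [listEval] at h
  push_cast at h
  linarith

theorem exp_one_eighth_le : Real.exp (1 / 8) ≤ 1.1332 := by
  refine le_of_pow_le_pow_left₀ (n := 8) (by norm_num) (by norm_num) ?_
  rw [← Real.exp_nat_mul]
  norm_num
  linarith [Real.exp_one_lt_d9]

theorem integral_mul_tanh_le :
    ∫ ξ in Set.Ioi (0 : ℝ),
        ξ * (listEval testCoeffsFT (ξ ^ 2) * Real.exp (-ξ ^ 2 / 2)) * Real.tanh (π * ξ)
      ≤ 0.58517 + 0.0412 := by
  set v : ℝ → ℝ := fun ξ => listEval testCoeffsFT (ξ ^ 2) * Real.exp (-ξ ^ 2 / 2) with hv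
  have hvi : IntegrableOn (fun ξ => ξ * v ξ) (Set.Ioi 0) := by
    have := integrableOn_listEval_mul_gauss testCoeffsFT 0
    simpa only [mul_zero, zero_add, pow_one, mul_assoc] using this
  have hvint : ∫ ξ in Set.Ioi (0 : ℝ), ξ * v ξ ≤ 0.58517 := by
    have := integral_listEval_mul_gauss testCoeffsFT 0
    simp only [mul_zero, zero_add, pow_one, mul_assoc] at this
    rw [this]
    have h : gaussHalfMoment 0 testCoeffsFT ≤ 0.58517 := by decide +kernel
    have h' : ((gaussHalfMoment 0 testCoeffsFT : ℚ) : ℝ) ≤ ((0.58517 : ℚ) : ℝ) :=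
      Rat.cast_le.2 h
    push_cast at h'
    exact h'
  obtain ⟨i1, e1⟩ := hasIntegral_pow_mul_expSum 1 2 (-2) 2 (-1)
  obtain ⟨i3, e3⟩ := hasIntegral_pow_mul_expSum 3 2 (-2) 1 0
  obtain ⟨i5, e5⟩ := hasIntegral_pow_mul_expSum 5 2 (-2) 2 (-1)
  have j1 := i1.const_mul 1.594
  have ij1 : IntegrableOn (fun ξ => ξ * v ξ + 1.594 * (ξ ^ 1 * expSum 2 (-2) 2 (-1) ξ)) (Set.Ioi 0) :=
    hvi.add j1
  have j3 := i3.const_mul 5.468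
  have ij3 : IntegrableOn (fun ξ => ξ * v ξ + 1.594 * (ξ ^ 1 * expSum 2 (-2) 2 (-1) ξ)
      - 5.468 * (ξ ^ 3 * expSum 2 (-2) 1 0 ξ)) (Set.Ioi 0) := ij1.sub j3
  have j5 := i5.const_mul 3.434
  have hti : IntegrableOn (fun ξ => ξ * v ξ * Real.tanh (π * ξ)) (Set.Ioi 0) := by
    refine Integrable.mono hvi ?_ (Filter.Eventually.of_forall fun ξ => ?_)
    · have hc : Continuous v := by
        have := continuous_listEval testCoeffsFT
        fun_prop
      have ht : Continuous fun ξ : ℝ => Real.tanh (π * ξ) := by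
        simp_rw [Real.tanh_eq_sinh_div_cosh]
        exact (by fun_prop : Continuous fun ξ => Real.sinh (π * ξ)).div (by fun_prop)
          fun ξ => (Real.cosh_pos _).ne'
      exact ((continuous_id.mul hc).mul ht).aestronglyMeasurable
    · rw [norm_mul]
      refine mul_le_of_le_one_right (norm_nonneg _) (abs_le.2 ⟨?_, ?_⟩)
      · exact (Real.neg_one_lt_tanh _).le
      · exact (Real.tanh_lt_one _).le
  calc ∫ ξ in Set.Ioi (0 : ℝ), ξ * v ξ * Real.tanh (π * ξ)
      ≤ ∫ ξ in Set.Ioi (0 : ℝ), (ξ * v ξ + 1.594 * (ξ ^ 1 * expSum 2 (-2) 2 (-1) ξ)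
          - 5.468 * (ξ ^ 3 * expSum 2 (-2) 1 0 ξ) + 3.434 * (ξ ^ 5 * expSum 2 (-2) 2 (-1) ξ)) := by
        refine setIntegral_mono_on hti (ij3.add j5) measurableSet_Ioi
          fun ξ hξ => ?_
        have hξ0 : 0 ≤ ξ := le_of_lt hξ
        have hm := minorant_le (sq_nonneg ξ)
        simp only [minorant, listEval] at hm
        push_cast at hm
        have hw : 0 ≤ ξ * (1 - Real.tanh (π * ξ)) :=
          mul_nonneg hξ0 (sub_nonneg.2 (Real.tanh_lt_one _).le)
        have h0 := mul_le_mul_of_nonneg_left hm hw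
        have h1 := mul_le_mul_of_nonneg_left (one_sub_tanh_le hξ0) hξ0
        have h3 := mul_le_mul_of_nonneg_left (le_one_sub_tanh hξ0) (pow_nonneg hξ0 3)
        have h5 := mul_le_mul_of_nonneg_left (one_sub_tanh_le hξ0) (pow_nonneg hξ0 5)
        change ξ * (1 - Real.tanh (π * ξ)) * _ ≤ ξ * (1 - Real.tanh (π * ξ)) * v ξ at h0
        linear_combination h0 + 1.594 * h1 + 5.468 * h3 + 3.434 * h5
    _ = (∫ ξ in Set.Ioi (0 : ℝ), ξ * v ξ)
          + 1.594 * (∫ ξ in Set.Ioi (0 : ℝ), ξ ^ 1 * expSum 2 (-2) 2 (-1) ξ)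
          - 5.468 * (∫ ξ in Set.Ioi (0 : ℝ), ξ ^ 3 * expSum 2 (-2) 1 0 ξ)
          + 3.434 * (∫ ξ in Set.Ioi (0 : ℝ), ξ ^ 5 * expSum 2 (-2) 2 (-1) ξ) := by
        rw [← integral_const_mul, ← integral_const_mul, ← integral_const_mul,
          ← integral_add hvi j1, ← integral_sub ij1 j3, ← integral_add ij3 j5]
    _ ≤ 0.58517 + 0.0412 := by
        have hπ := Real.pi_gt_d2
        have hπ' := Real.pi_lt_d2
        have b1 : ((1 : ℕ).factorial : ℝ) / (2 * π) ^ (1 + 1) ≤ 1 / 6.28 ^ 2 := by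
          rw [Nat.factorial_one, Nat.cast_one]
          exact div_le_div_of_nonneg_left (by norm_num) (by norm_num)
            (pow_le_pow_left₀ (by norm_num) (by linarith) 2)
        have b3 : (6 : ℝ) / 6.3 ^ 4 ≤ ((3 : ℕ).factorial : ℝ) / (2 * π) ^ (3 + 1) := by
          rw [show ((3 : ℕ).factorial : ℝ) = 6 by norm_num [Nat.factorial]]
          exact div_le_div_of_nonneg_left (by norm_num) (by positivity)
            (pow_le_pow_left₀ (by positivity) (by linarith) 4)
        have b5 : ((5 : ℕ).factorial : ℝ) / (2 * π) ^ (5 + 1) ≤ 120 / 6.28 ^ 6 := by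
          rw [show ((5 : ℕ).factorial : ℝ) = 120 by norm_num [Nat.factorial]]
          exact div_le_div_of_nonneg_left (by norm_num) (by norm_num)
            (pow_le_pow_left₀ (by norm_num) (by linarith) 6)
        rw [e1, e3, e5]
        norm_num at b1 b3 b5 hvint ⊢
        linarith

theorem stmt_1 :
    ∃ u : Polynomial ℝ,
      (let f : ℝ → ℝ := gaussPoly u
      let fhat : ℝ → ℝ := evenFT f
      (∀ x : ℝ, f x ≤ 0) ∧
      (∀ lam : ℝ, lam ∈ Set.Icc (1.04 : ℝ) 1.857 → fhat (Real.sqrt (lam - 1 / 4)) ≥ (0.673429 : ℝ)) ∧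
      (∀ lam : ℝ, (1.857 : ℝ) ≤ lam → fhat (Real.sqrt (lam - 1 / 4)) ≥ 0) ∧
      (1 / (0.673429 : ℝ)) *
          (4 * (∫ ξ in Set.Ioi (0 : ℝ), ξ * fhat ξ * Real.tanh (π * ξ))
            - (1 / Real.sqrt (2 * π)) * ∫ x : ℝ, f x * Real.cosh (x / 2)) ≤ 8.957) := by
  refine ⟨listPoly testCoeffs, fun x => ?_, fun lam hlam => ?_, fun lam hlam => ?_, ?_⟩
  · rw [gaussPoly_listPoly]
    exact mul_nonpos_of_nonpos_of_nonneg (testCoeffs_nonpos (sq_nonneg x)) (Real.exp_pos _).le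
  · obtain ⟨h1, h2⟩ := hlam
    rw [evenFT_gaussPoly, Real.sq_sqrt (by linarith)]
    exact testCoeffsFT_lower (by linarith) (by linarith)
  · rw [evenFT_gaussPoly, Real.sq_sqrt (by linarith)]
    exact mul_nonneg (testCoeffsFT_nonneg (by linarith)) (Real.exp_pos _).le
  · have h1 := integral_mul_tanh_le
    have h2 := neg_le_testCoeffsFT
    have h3 := exp_one_eighth_le
    have h4 := mul_le_mul_of_nonneg_right h2 (Real.exp_pos (1 / 8)).le
    simp only [evenFT_gaussPoly]
    rw [integral_gaussPoly_mul_cosh, one_div_mul_eq_div, div_le_iff₀ (by norm_num)]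
    change _ - listEval testCoeffsFT (-1 / 4) * _ ≤ _
    change 4 * (∫ ξ in Set.Ioi (0 : ℝ),
        ξ * (listEval testCoeffsFT (ξ ^ 2) * Real.exp (-ξ ^ 2 / 2)) * Real.tanh (π * ξ)) - _ ≤ _
    linarith
end

section
/- There exist a real polynomial u and a real constant c > 0 such that the even Schwartz function f(x) = u(x²) e^{−x²/2} satisfies: (i) f(x) ≤ 0 for all x ≥ 3.9359; (ii) f̂(√(λ − 1/4)) ≥ c for all λ ∈ [2.575, 5.5]; (iii) f̂(√(λ − 1/4)) ≥ 0 for all λ ≥ 5.5; (iv) writing L₁ = 8·arccosh(1/2 + cos(2π/7)) and L₂ = 6·arccosh(8 cos⁴(π/7) − 6 cos²(π/7) + 1), one has (1/c) · ( 4 ∫₀^∞ ξ f̂(ξ) tanh(πξ) dξ + (1/√(2π)) ( 21·L₁·f(L₁)/sinh(L₁/2) + 28·L₂·f(L₂)/sinh(L₂/2) ) − (1/√(2π)) ∫_ℝ f(x) cosh(x/2) dx ) < 12. -/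
open Real MeasureTheory

/-- The inverse of `cosh` mapping `[1, ∞)` to `[0, ∞)`, given by its standard
logarithmic formula. -/
noncomputable def Real.arccosh (x : ℝ) : ℝ :=
  Real.log (x + Real.sqrt (x ^ 2 - 1))

/-- The polynomials `P n z` with `∫ xⁿ exp (-x²/2 + z x) dx = √(2π) P n z exp (z²/2)`. -/
noncomputable def gaussMomentPoly : ℕ → ℂ → ℂ
  | 0, _ => 1
  | 1, z => z
  | n + 2, z => z * gaussMomentPoly (n + 1) z + (n + 1) * gaussMomentPoly n z

theorem integrable_pow_mul_cexp_quadratic (n : ℕ) (z : ℂ) :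
    Integrable fun x : ℝ => (x : ℂ) ^ n * Complex.exp (-(x : ℂ) ^ 2 / 2 + z * x) := by
  have hint (w : ℂ) : Integrable fun x : ℝ => Complex.exp (-(x : ℂ) ^ 2 / 2 + w * x) := by
    have h := integrable_cexp_quadratic' (b := -1 / 2) (by norm_num) w 0
    refine h.congr (Filter.Eventually.of_forall fun x => ?_)
    simp only
    congr 1
    ring
  have hg := (((hint (z + 1)).norm.add (hint (z - 1)).norm).const_mul (n.factorial : ℝ))
  refine hg.mono' (by fun_prop) (Filter.Eventually.of_forall fun x => ?_)
  have hpow : |x| ^ n ≤ n.factorial * (exp x + exp (-x)) := by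
    have h1 := Real.pow_div_factorial_le_exp |x| (abs_nonneg x) n
    rw [div_le_iff₀ (by positivity)] at h1
    have h2 : exp |x| ≤ exp x + exp (-x) := by
      rcases abs_cases x with h | h <;> rw [h.1] <;> linarith [exp_pos x, exp_pos (-x)]
    nlinarith [(Nat.cast_pos (α := ℝ)).2 n.factorial_pos]
  simp only [norm_mul, norm_pow, Complex.norm_real, Real.norm_eq_abs, Complex.norm_exp, Pi.add_apply]
  have e1 : (-(x : ℂ) ^ 2 / 2 + (z + 1) * x).re = (-(x : ℂ) ^ 2 / 2 + z * x).re + x := by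
    simp; ring
  have e2 : (-(x : ℂ) ^ 2 / 2 + (z - 1) * x).re = (-(x : ℂ) ^ 2 / 2 + z * x).re + -x := by
    simp; ring
  rw [e1, e2, exp_add, exp_add]
  nlinarith [exp_pos (-(x : ℂ) ^ 2 / 2 + z * x).re]

theorem integral_pow_mul_cexp_quadratic (n : ℕ) (z : ℂ) :
    ∫ x : ℝ, (x : ℂ) ^ n * Complex.exp (-(x : ℂ) ^ 2 / 2 + z * x) =
      √(2 * π) * gaussMomentPoly n z * Complex.exp (z ^ 2 / 2) := by
  have hder (m : ℕ) (x : ℝ) :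
      HasDerivAt (fun x : ℝ => (x : ℂ) ^ m * Complex.exp (-(x : ℂ) ^ 2 / 2 + z * x))
        ((m * (x : ℂ) ^ (m - 1) * Complex.exp (-(x : ℂ) ^ 2 / 2 + z * x)
          + z * ((x : ℂ) ^ m * Complex.exp (-(x : ℂ) ^ 2 / 2 + z * x)))
          - (x : ℂ) ^ (m + 1) * Complex.exp (-(x : ℂ) ^ 2 / 2 + z * x)) x := by
    have h : HasDerivAt (fun w : ℂ => w ^ m * Complex.exp (-w ^ 2 / 2 + z * w))
        ((m * (x : ℂ) ^ (m - 1)) * Complex.exp (-(x : ℂ) ^ 2 / 2 + z * x)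
          + (x : ℂ) ^ m * (Complex.exp (-(x : ℂ) ^ 2 / 2 + z * x) *
            (-(2 * (x : ℂ)) / 2 + z))) x := by
      refine (hasDerivAt_pow m (x : ℂ)).mul (HasDerivAt.cexp ?_)
      have h2 := ((hasDerivAt_pow 2 (x : ℂ)).fun_neg.div_const 2).fun_add
        ((hasDerivAt_id' (x : ℂ)).const_mul z)
      simpa using h2
    convert h.comp_ofReal using 1
    ring
  have hI := fun m => integrable_pow_mul_cexp_quadratic m z
  have hI' (m : ℕ) : Integrable fun x : ℝ =>
      (m : ℂ) * (x : ℂ) ^ (m - 1) * Complex.exp (-(x : ℂ) ^ 2 / 2 + z * x) := by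
    simpa only [mul_assoc] using (hI (m - 1)).const_mul (m : ℂ)
  have hrec (m : ℕ) := integral_eq_zero_of_hasDerivAt_of_integrable (hder m)
    (((hI' m).add ((hI m).const_mul z)).sub (hI (m + 1))) (hI m)
  have hrec' (m : ℕ) : ∫ x : ℝ, (x : ℂ) ^ (m + 1) * Complex.exp (-(x : ℂ) ^ 2 / 2 + z * x) =
      m * (∫ x : ℝ, (x : ℂ) ^ (m - 1) * Complex.exp (-(x : ℂ) ^ 2 / 2 + z * x)) +
      z * ∫ x : ℝ, (x : ℂ) ^ m * Complex.exp (-(x : ℂ) ^ 2 / 2 + z * x) := by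
    have h := hrec m
    rw [integral_sub _ (hI (m + 1)), integral_add (hI' m) ((hI m).const_mul z),
      integral_const_mul] at h
    swap
    · exact (hI' m).add ((hI m).const_mul z)
    simp only [mul_assoc, integral_const_mul] at h
    exact (sub_eq_zero.1 h).symm
  have h0 : ∫ x : ℝ, (x : ℂ) ^ 0 * Complex.exp (-(x : ℂ) ^ 2 / 2 + z * x) =
      √(2 * π) * gaussMomentPoly 0 z * Complex.exp (z ^ 2 / 2) := by
    have h := integral_cexp_quadratic (b := -1 / 2) (by norm_num) z 0
    have hs : ((π : ℂ) / -(-1 / 2)) ^ (1 / 2 : ℂ) = √(2 * π) := by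
      rw [Real.sqrt_eq_rpow, Complex.ofReal_cpow (by positivity)]
      push_cast
      congr 1
      ring
    rw [hs] at h
    rw [gaussMomentPoly, mul_one]
    convert h using 2
    · ext x
      rw [pow_zero, one_mul]
      congr 1
      ring
    · congr 1
      ring
  induction n using Nat.strong_induction_on with
  | _ n ih =>
    match n with
    | 0 => exact h0
    | 1 =>
      rw [hrec' 0, h0]
      simp only [gaussMomentPoly]
      push_cast
      ring
    | m + 2 =>
      rw [hrec' (m + 1), Nat.add_sub_cancel, ih m (by omega), ih (m + 1) (by omega),
        gaussMomentPoly]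
      push_cast
      ring

theorem ofReal_gaussPoly_mul_cexp (u : Polynomial ℝ) (z : ℂ) (x : ℝ) :
    (gaussPoly u x : ℂ) * Complex.exp (z * x) = ∑ k ∈ Finset.range (u.natDegree + 1),
      (u.coeff k : ℂ) * ((x : ℂ) ^ (2 * k) * Complex.exp (-(x : ℂ) ^ 2 / 2 + z * x)) := by
  rw [gaussPoly, Polynomial.eval_eq_sum_range, Complex.ofReal_mul, Complex.ofReal_sum,
    mul_assoc, Finset.sum_mul]
  refine Finset.sum_congr rfl fun k _ => ?_
  rw [Complex.exp_add]
  push_cast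
  ring

theorem integrable_gaussPoly_mul_cexp (u : Polynomial ℝ) (z : ℂ) :
    Integrable fun x : ℝ => (gaussPoly u x : ℂ) * Complex.exp (z * x) := by
  simp only [ofReal_gaussPoly_mul_cexp]
  exact integrable_finsetSum _ fun k _ => (integrable_pow_mul_cexp_quadratic (2 * k) z).const_mul _

theorem integral_gaussPoly_mul_cexp (u : Polynomial ℝ) (z : ℂ) :
    ∫ x : ℝ, (gaussPoly u x : ℂ) * Complex.exp (z * x) =
      √(2 * π) * (∑ k ∈ Finset.range (u.natDegree + 1), (u.coeff k : ℂ) * gaussMomentPoly (2 * k) z)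
        * Complex.exp (z ^ 2 / 2) := by
  simp only [ofReal_gaussPoly_mul_cexp]
  rw [integral_finsetSum _ fun k _ => (integrable_pow_mul_cexp_quadratic (2 * k) z).const_mul _,
    Finset.mul_sum, Finset.sum_mul]
  refine Finset.sum_congr rfl fun k _ => ?_
  rw [integral_const_mul, integral_pow_mul_cexp_quadratic]
  ring

theorem evenFT_gaussPoly_s4 {u v : Polynomial ℝ}
    (huv : ∀ z : ℂ, ∑ k ∈ Finset.range (u.natDegree + 1), (u.coeff k : ℂ) * gaussMomentPoly (2 * k) z
      = Polynomial.aeval (-z ^ 2) v) (ξ : ℝ) :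
    evenFT (gaussPoly u) ξ = gaussPoly v ξ := by
  have h := integral_gaussPoly_mul_cexp u (ξ * Complex.I)
  have hsq : ((ξ : ℂ) * Complex.I) ^ 2 = ((-ξ ^ 2 : ℝ) : ℂ) := by
    rw [mul_pow, Complex.I_sq]; push_cast; ring
  have hv : Polynomial.aeval (-((-ξ ^ 2 : ℝ) : ℂ)) v = ((v.eval (ξ ^ 2) : ℝ) : ℂ) := by
    rw [← Complex.ofReal_neg, neg_neg]
    exact Polynomial.aeval_algebraMap_apply_eq_algebraMap_eval (A := ℂ) (ξ ^ 2) v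
  rw [huv, hsq, hv] at h
  have h2 := congrArg Complex.re h
  have hre := integral_re (integrable_gaussPoly_mul_cexp u (ξ * Complex.I))
  simp only [RCLike.re_eq_complex_re] at hre
  rw [← hre] at h2
  have hs : √(2 * π) ≠ 0 := by positivity
  have hi : ∀ x : ℝ, ((gaussPoly u x : ℂ) * Complex.exp (ξ * Complex.I * x)).re
      = gaussPoly u x * cos (ξ * x) := by
    intro x
    rw [Complex.re_ofReal_mul, show (ξ : ℂ) * Complex.I * x = ((ξ * x : ℝ) : ℂ) * Complex.I by
      push_cast; ring, Complex.exp_ofReal_mul_I_re]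
  simp only [hi] at h2
  rw [evenFT, h2, gaussPoly]
  rw [show ((-ξ ^ 2 : ℝ) : ℂ) / 2 = ((-ξ ^ 2 / 2 : ℝ) : ℂ) by push_cast; ring,
    ← Complex.ofReal_exp, ← Complex.ofReal_mul, ← Complex.ofReal_mul, Complex.ofReal_re]
  field_simp

theorem integral_gaussPoly_mul_cosh_s4 {u v : Polynomial ℝ}
    (huv : ∀ z : ℂ, ∑ k ∈ Finset.range (u.natDegree + 1), (u.coeff k : ℂ) * gaussMomentPoly (2 * k) z
      = Polynomial.aeval (-z ^ 2) v) (a : ℝ) :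
    ∫ x : ℝ, gaussPoly u x * cosh (a * x) =
      √(2 * π) * (v.eval (-a ^ 2) * exp (a ^ 2 / 2)) := by
  have key (b : ℝ) : Integrable (fun x : ℝ => gaussPoly u x * exp (b * x)) ∧
      ∫ x : ℝ, gaussPoly u x * exp (b * x) = √(2 * π) * (v.eval (-b ^ 2) * exp (b ^ 2 / 2)) := by
    have h := integral_gaussPoly_mul_cexp u b
    have hI := integrable_gaussPoly_mul_cexp u b
    have hv : Polynomial.aeval (-(b : ℂ) ^ 2) v = ((v.eval (-b ^ 2) : ℝ) : ℂ) := by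
      rw [show -(b : ℂ) ^ 2 = ((-b ^ 2 : ℝ) : ℂ) by push_cast; ring]
      exact Polynomial.aeval_algebraMap_apply_eq_algebraMap_eval (A := ℂ) (-b ^ 2) v
    have hi (x : ℝ) : (gaussPoly u x : ℂ) * Complex.exp (b * x) =
        ((gaussPoly u x * exp (b * x) : ℝ) : ℂ) := by push_cast; rfl
    rw [huv, hv] at h
    simp only [hi] at h hI
    refine ⟨by simpa only [RCLike.re_eq_complex_re, Complex.ofReal_re] using hI.re, ?_⟩
    rw [integral_complex_ofReal] at h
    apply Complex.ofReal_injective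
    rw [h]
    push_cast
    ring
  have hc (x : ℝ) : gaussPoly u x * cosh (a * x) =
      (gaussPoly u x * exp (a * x) + gaussPoly u x * exp (-a * x)) / 2 := by
    rw [Real.cosh_eq, neg_mul]; ring
  simp only [hc]
  rw [integral_div, integral_add (key a).1 (key (-a)).1, (key a).2, (key (-a)).2]
  rw [neg_sq]
  ring


/-- The polynomial `u` of the test function `u(x²) exp (-x²/2)`. -/
noncomputable def testPoly : Polynomial ℝ :=
  Polynomial.C (-100) * Polynomial.X ^ 9 + Polynomial.C 5165 * Polynomial.X ^ 8
    + Polynomial.C (-121860) * Polynomial.X ^ 7 + Polynomial.C 1547297 * Polynomial.X ^ 6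
    + Polynomial.C (-11083576) * Polynomial.X ^ 5 + Polynomial.C 49262202 * Polynomial.X ^ 4
    + Polynomial.C (-85020336) * Polynomial.X ^ 3 + Polynomial.C 272363220 * Polynomial.X ^ 2
    + Polynomial.C 707577120 * Polynomial.X + Polynomial.C 3674312280

/-- The polynomial `v` such that `v(ξ²) exp (-ξ²/2)` is the Fourier transform of the test
function. -/
noncomputable def testPolyFT : Polynomial ℝ :=
  (9 - Polynomial.X) ^ 2 * (15 - Polynomial.X) ^ 2 * (25 - Polynomial.X) ^ 2 *
    (100 * Polynomial.X ^ 3 - 335 * Polynomial.X ^ 2 + 130 * Polynomial.X + 462)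

theorem testPolyFT_eval (t : ℝ) : testPolyFT.eval t =
    (9 - t) ^ 2 * (15 - t) ^ 2 * (25 - t) ^ 2 * (100 * t ^ 3 - 335 * t ^ 2 + 130 * t + 462) := by
  simp [testPolyFT]

theorem testPoly_eval (t : ℝ) : testPoly.eval t = -100 * t ^ 9 + 5165 * t ^ 8 - 121860 * t ^ 7
    + 1547297 * t ^ 6 - 11083576 * t ^ 5 + 49262202 * t ^ 4 - 85020336 * t ^ 3 + 272363220 * t ^ 2
    + 707577120 * t + 3674312280 := by
  simp [testPoly]
  ring

theorem testPoly_natDegree : testPoly.natDegree = 9 := by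
  rw [testPoly]
  compute_degree!

theorem testPoly_gaussMomentPoly (z : ℂ) :
    ∑ k ∈ Finset.range (testPoly.natDegree + 1), (testPoly.coeff k : ℂ) * gaussMomentPoly (2 * k) z
      = Polynomial.aeval (-z ^ 2) testPolyFT := by
  rw [testPoly_natDegree]
  have haeval : Polynomial.aeval (-z ^ 2) testPolyFT =
      (9 + z ^ 2) ^ 2 * (15 + z ^ 2) ^ 2 * (25 + z ^ 2) ^ 2 *
        (-100 * z ^ 6 - 335 * z ^ 4 - 130 * z ^ 2 + 462) := by
    simp only [testPolyFT, map_mul, map_pow, map_sub, map_add, map_ofNat, Polynomial.aeval_X]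
    ring
  rw [haeval]
  simp only [Finset.sum_range_succ, Finset.sum_range_zero, testPoly, Polynomial.coeff_add,
    Polynomial.coeff_C_mul, Polynomial.coeff_X_pow, Polynomial.coeff_X, Polynomial.coeff_C]
  norm_num [gaussMomentPoly]
  ring

theorem testPoly_eval_nonpos {t : ℝ} (ht : 15.491 ≤ t) : testPoly.eval t ≤ 0 := by
  obtain ⟨s, hs, rfl⟩ : ∃ s : ℝ, 0 ≤ s ∧ t = 15.491 + s := ⟨t - 15.491, by linarith, by ring⟩
  rw [testPoly_eval, ← neg_nonneg]
  ring_nf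
  positivity

theorem testPoly_eval_le {t : ℝ} (ht : 27.123 ≤ t) : testPoly.eval t ≤ -119 * 10 ^ 12 := by
  obtain ⟨s, hs, rfl⟩ : ∃ s : ℝ, 0 ≤ s ∧ t = 27.123 + s := ⟨t - 27.123, by linarith, by ring⟩
  rw [testPoly_eval, ← sub_nonneg]
  ring_nf
  positivity

theorem testPolyFT_eval_nonneg {t : ℝ} (ht : 0 ≤ t) : 0 ≤ testPolyFT.eval t := by
  have hcubic : 0 ≤ 100 * t ^ 3 - 335 * t ^ 2 + 130 * t + 462 := by
    nlinarith [mul_nonneg ht (sq_nonneg (t - 2)), sq_nonneg (t - 2)]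
  rw [testPolyFT_eval]
  positivity

theorem exp_two_lt : exp 2 < 7.39 := by
  have h : exp 2 = exp 1 ^ 2 := by rw [← exp_nat_mul]; norm_num
  rw [h]
  calc exp 1 ^ 2 < 2.7182818286 ^ 2 := by gcongr; exact exp_one_lt_d9
    _ < 7.39 := by norm_num

theorem testPolyFT_mul_exp_ge {t : ℝ} (ht : 2.325 ≤ t) (ht' : t ≤ 5.25) :
    240000000 ≤ testPolyFT.eval t * exp (-t / 2) := by
  have hexp : exp (t / 2) ≤ 7.39 * (1 + (t / 2 - 2) + (t / 2 - 2) ^ 2 / 2 + (t / 2 - 2) ^ 3 / 6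
      + (t / 2 - 2) ^ 4 / 24 + (t / 2 - 2) ^ 5 / 120 + (t / 2 - 2) ^ 6 * (7 / 4320)) := by
    have hr : |t / 2 - 2| ≤ 1 := abs_le.2 ⟨by linarith, by linarith⟩
    have h := (abs_le.1 (exp_bound hr (n := 6) (by norm_num))).2
    rw [show |t / 2 - 2| ^ 6 = (t / 2 - 2) ^ 6 from (by decide : Even 6).pow_abs _] at h
    norm_num [Finset.sum_range_succ, Nat.factorial] at h
    have hsplit : exp (t / 2) = exp 2 * exp (t / 2 - 2) := by rw [← exp_add]; ring_nf
    rw [hsplit]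
    exact mul_le_mul exp_two_lt.le (by linarith) (exp_pos _).le (by norm_num)
  have hpoly : 240000000 * (7.39 * (1 + (t / 2 - 2) + (t / 2 - 2) ^ 2 / 2 + (t / 2 - 2) ^ 3 / 6
      + (t / 2 - 2) ^ 4 / 24 + (t / 2 - 2) ^ 5 / 120 + (t / 2 - 2) ^ 6 * (7 / 4320))) ≤
      testPolyFT.eval t := by
    have hp : 0 ≤ t - 9 / 4 := by linarith
    have hq : 0 ≤ 21 / 4 - t := by linarith
    have hquot : 0 ≤ 366071862456335 * (21 / 4 - t) ^ 7
        + 2211767432232071 * ((t - 9 / 4) * (21 / 4 - t) ^ 6)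
        + 5378551817489871 * ((t - 9 / 4) ^ 2 * (21 / 4 - t) ^ 5)
        + 6820400808968623 * ((t - 9 / 4) ^ 3 * (21 / 4 - t) ^ 4)
        + 4794912017048869 * ((t - 9 / 4) ^ 4 * (21 / 4 - t) ^ 3)
        + 1783101043553469 * ((t - 9 / 4) ^ 5 * (21 / 4 - t) ^ 2)
        + 276094139242109 * ((t - 9 / 4) ^ 6 * (21 / 4 - t))
        + 446547822221 * (t - 9 / 4) ^ 7 := by positivity
    rw [testPolyFT_eval]
    linear_combination (1 / 859963392 * (t - 19 / 8) ^ 2) * hquot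
      + 5087846458739 / 12582912 * hp
      + (1037680842657701 / 301989888 - 5087846458739 / 12582912 / 8) * zero_le_one' ℝ
  calc (240000000 : ℝ) = 240000000 * exp (t / 2) * exp (-t / 2) := by
        rw [mul_assoc, ← exp_add, neg_div, add_neg_cancel, exp_zero, mul_one]
    _ ≤ testPolyFT.eval t * exp (-t / 2) := by
        gcongr
        linarith

theorem testPolyFT_mul_exp_ge_linear {t : ℝ} (ht : 0 ≤ t) :
    5262468750 - 4176000000 * t ≤ testPolyFT.eval t * exp (-t / 2) := by
  rcases le_total t (3 / 2) with ht' | ht'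
  · have hexp : 1 - t / 2 + t ^ 2 / 8 - t ^ 3 / 36 ≤ exp (-t / 2) := by
      have hr : |-t / 2| ≤ 1 := abs_le.2 ⟨by linarith, by linarith⟩
      have h := (abs_le.1 (exp_bound hr (n := 3) (by norm_num))).1
      rw [show |-t / 2| = t / 2 by rw [neg_div, abs_neg, abs_of_nonneg (by linarith)]] at h
      norm_num [Finset.sum_range_succ, Nat.factorial] at h
      linear_combination h
    have hq : 0 ≤ 3 / 2 - t := by linarith
    have hquot : 0 ≤ 333800960000 * (3 / 2 - t) ^ 11
        + 1627247987200 * (t * (3 / 2 - t) ^ 10)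
        + 2684789000960 * (t ^ 2 * (3 / 2 - t) ^ 9)
        + 1836060470592 * (t ^ 3 * (3 / 2 - t) ^ 8)
        + 5420033404608 * (t ^ 4 * (3 / 2 - t) ^ 7)
        + 23697827749104 * (t ^ 5 * (3 / 2 - t) ^ 6)
        + 48967189505088 * (t ^ 6 * (3 / 2 - t) ^ 5)
        + 57225866790540 * (t ^ 7 * (3 / 2 - t) ^ 4)
        + 40980317598204 * (t ^ 8 * (3 / 2 - t) ^ 3)
        + 17986309407239 * (t ^ 9 * (3 / 2 - t) ^ 2)
        + 4471978103515 * (t ^ 10 * (3 / 2 - t))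
        + 484796058350 * t ^ 11 := by positivity
    have hpoly : 5262468750 - 4176000000 * t ≤
        testPolyFT.eval t * (1 - t / 2 + t ^ 2 / 8 - t ^ 3 / 36) := by
      rw [testPolyFT_eval]
      linear_combination (1 / 39366 * t) * hquot
    exact hpoly.trans (mul_le_mul_of_nonneg_left hexp (testPolyFT_eval_nonneg ht))
  · have := mul_nonneg (testPolyFT_eval_nonneg ht) (exp_pos (-t / 2)).le
    linarith

theorem integrableOn_Ioi_pow_mul_exp_neg_mul (n : ℕ) {a : ℝ} (ha : 0 < a) :
    IntegrableOn (fun x : ℝ => x ^ n * exp (-(a * x))) (Set.Ioi 0) := by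
  simpa using integrableOn_rpow_mul_exp_neg_mul_rpow (s := n) (p := 1) (b := a)
    (by linarith [n.cast_nonneg (α := ℝ)]) one_pos ha

theorem integral_Ioi_pow_mul_exp_neg_mul (n : ℕ) {a : ℝ} (ha : 0 < a) :
    ∫ x in Set.Ioi 0, x ^ n * exp (-(a * x)) = n.factorial / a ^ (n + 1) := by
  have h := integral_rpow_mul_exp_neg_mul_Ioi (a := n + 1) (r := a) (by positivity) ha
  simp only [add_sub_cancel_right, rpow_natCast, Gamma_nat_eq_factorial] at h
  rw [h, ← Nat.cast_succ, rpow_natCast, one_div, inv_pow, inv_mul_eq_div]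

theorem integrableOn_Ioi_pow_mul_exp_neg_sq_half (n : ℕ) :
    IntegrableOn (fun x : ℝ => x ^ n * exp (-x ^ 2 / 2)) (Set.Ioi 0) := by
  have h := integrableOn_rpow_mul_exp_neg_mul_sq (b := 1 / 2) one_half_pos (s := n)
    (by linarith [n.cast_nonneg (α := ℝ)])
  simp only [rpow_natCast] at h
  refine h.congr_fun (fun x _ => ?_) measurableSet_Ioi
  ring_nf

theorem integral_Ioi_pow_odd_mul_exp_neg_sq_half (k : ℕ) :
    ∫ x in Set.Ioi (0 : ℝ), x ^ (2 * k + 1) * exp (-x ^ 2 / 2) = 2 ^ k * k.factorial := by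
  have h := integral_rpow_mul_exp_neg_mul_rpow (p := 2) (q := (2 * k + 1 : ℕ)) (b := 1 / 2)
    two_pos (by linarith [(2 * k + 1).cast_nonneg (α := ℝ)]) one_half_pos
  have hexp : (((2 * k + 1 : ℕ) : ℝ) + 1) / 2 = ((k + 1 : ℕ) : ℝ) := by push_cast; ring
  rw [neg_div, hexp, rpow_neg (by norm_num), rpow_natCast, Nat.cast_succ k,
    Gamma_nat_eq_factorial] at h
  simp only [rpow_natCast, rpow_two] at h
  calc _ = ∫ x in Set.Ioi (0 : ℝ), x ^ (2 * k + 1) * exp (-(1 / 2) * x ^ 2) := by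
        congr 1; ext x; ring_nf
    _ = _ := by
        rw [h, one_div, inv_pow, inv_inv, pow_succ]
        ring

theorem id_mul_gaussPoly_eq_sum (p : Polynomial ℝ) (x : ℝ) : x * gaussPoly p x =
    ∑ k ∈ Finset.range (p.natDegree + 1), p.coeff k * (x ^ (2 * k + 1) * exp (-x ^ 2 / 2)) := by
  rw [gaussPoly, Polynomial.eval_eq_sum_range, Finset.sum_mul, Finset.mul_sum]
  exact Finset.sum_congr rfl fun k _ => by ring

theorem integrableOn_Ioi_id_mul_gaussPoly (p : Polynomial ℝ) :
    IntegrableOn (fun x => x * gaussPoly p x) (Set.Ioi 0) := by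
  simp only [id_mul_gaussPoly_eq_sum]
  exact integrable_finsetSum _ fun k _ =>
    (integrableOn_Ioi_pow_mul_exp_neg_sq_half (2 * k + 1)).const_mul _

theorem integral_Ioi_id_mul_gaussPoly (p : Polynomial ℝ) :
    ∫ x in Set.Ioi 0, x * gaussPoly p x =
      ∑ k ∈ Finset.range (p.natDegree + 1), p.coeff k * (2 ^ k * k.factorial) := by
  simp only [id_mul_gaussPoly_eq_sum]
  rw [integral_finsetSum _ fun k _ =>
    (integrableOn_Ioi_pow_mul_exp_neg_sq_half (2 * k + 1)).const_mul _]
  simp only [integral_const_mul, integral_Ioi_pow_odd_mul_exp_neg_sq_half]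

theorem integral_Ioi_id_mul_gaussPoly_testPolyFT :
    ∫ x in Set.Ioi 0, x * gaussPoly testPolyFT x = 2683544658 := by
  have hexpand : testPolyFT = Polynomial.C 100 * Polynomial.X ^ 9
      + Polynomial.C (-10135) * Polynomial.X ^ 8 + Polynomial.C 420060 * Polynomial.X ^ 7
      + Polynomial.C (-9187063) * Polynomial.X ^ 6 + Polynomial.C 113946754 * Polynomial.X ^ 5
      + Polynomial.C (-796354623) * Polynomial.X ^ 4 + Polynomial.C 2877911640 * Polynomial.X ^ 3
      + Polynomial.C (-4058431425) * Polynomial.X ^ 2 + Polynomial.C (-811316250) * Polynomial.X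
      + Polynomial.C 5262468750 := by
    simp only [testPolyFT, map_neg, map_ofNat]
    ring
  have hdeg : testPolyFT.natDegree = 9 := by
    rw [hexpand]
    compute_degree!
  rw [integral_Ioi_id_mul_gaussPoly, hdeg, hexpand]
  simp only [Finset.sum_range_succ, Finset.sum_range_zero, Polynomial.coeff_add,
    Polynomial.coeff_C_mul, Polynomial.coeff_X_pow, Polynomial.coeff_X, Polynomial.coeff_C]
  norm_num [Nat.factorial]

theorem tanh_eq_one_sub (x : ℝ) :
    tanh x = 1 - 2 * (exp (-(2 * x)) / (1 + exp (-(2 * x)))) := by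
  have h : exp (-(2 * x)) = exp (-x) ^ 2 := by rw [← exp_nat_mul]; ring_nf
  have hx : exp (-x) * exp x = 1 := by rw [← exp_add, neg_add_cancel, exp_zero]
  rw [tanh_eq, h]
  field_simp
  linear_combination (2 * exp (-x)) * hx

theorem integral_Ioi_id_mul_mul_tanh_le (F : ℝ → ℝ) {A B : ℝ} (hA : 0 ≤ A) (hB : 0 ≤ B)
    (hF : IntegrableOn (fun x => x * F x) (Set.Ioi 0)) (hF₀ : ∀ x, 0 ≤ F x)
    (hFAB : ∀ x, A - B * x ^ 2 ≤ F x) :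
    ∫ x in Set.Ioi (0 : ℝ), x * F x * tanh (π * x) ≤
      (∫ x in Set.Ioi (0 : ℝ), x * F x)
        - 2 * A * ((1 - 1 / 4 + 1 / 9 - 1 / 16 + 1 / 50) / (2 * π) ^ 2)
        + 2 * B * (6 / (2 * π) ^ 4) := by
  set E : ℕ → ℕ → ℝ → ℝ := fun n k x => x ^ n * exp (-(k * (2 * π) * x)) with hE
  have hEi (n : ℕ) {k : ℕ} (hk : 0 < k) : IntegrableOn (E n k) (Set.Ioi 0) :=
    integrableOn_Ioi_pow_mul_exp_neg_mul n (by positivity)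
  have hEv (n : ℕ) {k : ℕ} (hk : 0 < k) :
      ∫ x in Set.Ioi 0, E n k x = n.factorial / (k * (2 * π)) ^ (n + 1) :=
    integral_Ioi_pow_mul_exp_neg_mul n (by positivity)
  have hEpow (n k : ℕ) (x : ℝ) : E n k x = x ^ n * exp (-(2 * (π * x))) ^ k := by
    rw [hE, ← exp_nat_mul]
    ring_nf
  set G : ℝ → ℝ := E 1 1 - E 1 2 + E 1 3 - E 1 4 + (1 / 2 : ℝ) • E 1 5 with hG
  have hGi : IntegrableOn G (Set.Ioi 0) :=
    ((((hEi 1 one_pos).sub (hEi 1 two_pos)).add (hEi 1 three_pos)).sub (hEi 1 four_pos)).add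
      ((hEi 1 (Nat.succ_pos 4)).smul _)
  have hGv : ∫ x in Set.Ioi 0, G x =
      (1 - 1 / 4 + 1 / 9 - 1 / 16 + 1 / 50) / (2 * π) ^ 2 := by
    rw [hG, integral_add' ((((hEi 1 one_pos).sub (hEi 1 two_pos)).add (hEi 1 three_pos)).sub
      (hEi 1 four_pos)) ((hEi 1 (Nat.succ_pos 4)).smul _),
      integral_sub' (((hEi 1 one_pos).sub (hEi 1 two_pos)).add (hEi 1 three_pos)) (hEi 1 four_pos),
      integral_add' ((hEi 1 one_pos).sub (hEi 1 two_pos)) (hEi 1 three_pos),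
      integral_sub' (hEi 1 one_pos) (hEi 1 two_pos)]
    simp only [Pi.smul_apply, smul_eq_mul, integral_const_mul]
    rw [hEv 1 one_pos, hEv 1 two_pos, hEv 1 three_pos, hEv 1 four_pos, hEv 1 (Nat.succ_pos 4)]
    norm_num [mul_pow]
    ring
  have hbound : ∫ x in Set.Ioi (0 : ℝ), x * F x * tanh (π * x) ≤
      ∫ x in Set.Ioi 0, ((fun x => x * F x) - (2 * A) • G + (2 * B) • E 3 1) x := by
    refine integral_mono_of_nonneg ?_
      ((hF.sub (hGi.smul _)).add ((hEi 3 one_pos).smul _)) ?_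
    · refine (ae_restrict_iff' measurableSet_Ioi).2 (.of_forall fun x (hx : 0 < x) => ?_)
      have htanh : 0 ≤ tanh (π * x) := by
        rw [tanh_eq_sinh_div_cosh]
        exact div_nonneg (sinh_nonneg_iff.2 (by positivity)) (cosh_pos _).le
      exact mul_nonneg (mul_nonneg hx.le (hF₀ x)) htanh
    · refine (ae_restrict_iff' measurableSet_Ioi).2 (.of_forall fun x (hx : 0 < x) => ?_)
      simp only [hG, Pi.add_apply, Pi.sub_apply, Pi.smul_apply, smul_eq_mul, hEpow,
        tanh_eq_one_sub]
      have hq : 0 < exp (-(2 * (π * x))) := exp_pos _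
      have hq' : exp (-(2 * (π * x))) ≤ 1 := exp_le_one_iff.2 (by
        have := mul_pos pi_pos hx
        linarith)
      set q := exp (-(2 * (π * x)))
      have hlower : q - q ^ 2 + q ^ 3 - q ^ 4 + 1 / 2 * q ^ 5 ≤ q / (1 + q) := by
        rw [le_div_iff₀ (by positivity)]
        nlinarith [mul_nonneg (pow_pos hq 5).le (sub_nonneg.2 hq')]
      have hupper : q / (1 + q) ≤ q := div_le_self hq.le (by linarith)
      have hw : 0 ≤ q / (1 + q) := by positivity
      have h₁ := mul_le_mul_of_nonneg_left (hFAB x) (mul_nonneg hx.le hw)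
      have h₂ := mul_le_mul_of_nonneg_left hlower (mul_nonneg hA hx.le)
      have h₃ := mul_le_mul_of_nonneg_left hupper (mul_nonneg hB (pow_pos hx 3).le)
      linear_combination 2 * h₁ + 2 * h₂ + 2 * h₃
  refine hbound.trans_eq ?_
  rw [integral_add' (hF.sub (hGi.smul _)) ((hEi 3 one_pos).smul _),
    integral_sub' hF (hGi.smul _)]
  simp only [Pi.smul_apply, smul_eq_mul, integral_const_mul]
  rw [hGv, hEv 3 one_pos]
  norm_num [Nat.factorial]

theorem integral_Ioi_gaussPoly_testPolyFT_mul_tanh_le :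
    ∫ x in Set.Ioi (0 : ℝ), x * gaussPoly testPolyFT x * tanh (π * x) ≤ 2500000000 := by
  have h := integral_Ioi_id_mul_mul_tanh_le (gaussPoly testPolyFT) (A := 5262468750)
    (B := 4176000000) (by norm_num) (by norm_num) (integrableOn_Ioi_id_mul_gaussPoly _)
    (fun x => mul_nonneg (testPolyFT_eval_nonneg (sq_nonneg x)) (exp_pos _).le)
    (fun x => testPolyFT_mul_exp_ge_linear (sq_nonneg x))
  rw [integral_Ioi_id_mul_gaussPoly_testPolyFT] at h
  have hlower : 1 / (2 * 3.1416) ^ 2 ≤ 1 / (2 * π) ^ 2 := by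
    gcongr
    exact pi_lt_d4.le
  have hupper : 1 / (2 * π) ^ 4 ≤ 1 / (2 * 3.14) ^ 4 := by
    gcongr
    exact pi_gt_d2.le
  rw [div_eq_mul_one_div _ ((2 * π) ^ 2), div_eq_mul_one_div 6] at h
  linarith

theorem le_arccosh {x s t : ℝ} (hs : s ^ 2 ≤ x ^ 2 - 1) (ht : exp t ≤ x + s) :
    t ≤ Real.arccosh x := by
  have h : exp t ≤ x + √(x ^ 2 - 1) := by linarith [le_sqrt_of_sq_le hs]
  exact (le_log_iff_exp_le ((exp_pos t).trans_le h)).2 h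

theorem arccosh_le {x s t : ℝ} (hx : 0 < x) (hs₀ : 0 ≤ s) (hs : x ^ 2 - 1 ≤ s ^ 2)
    (ht : x + s ≤ exp t) : Real.arccosh x ≤ t :=
  (log_le_iff_le_exp (by positivity)).2 (by linarith [(sqrt_le_left hs₀).2 hs])

theorem cos_pi_div_seven_cubic :
    8 * cos (π / 7) ^ 3 - 4 * cos (π / 7) ^ 2 - 4 * cos (π / 7) + 1 = 0 := by
  have hpos : 0 < cos (π / 7) :=
    cos_pos_of_mem_Ioo ⟨by linarith [pi_pos], by linarith [pi_pos]⟩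
  have h₃ := cos_three_mul (π / 7)
  have h₄ : cos (3 * (π / 7)) = -(2 * (2 * cos (π / 7) ^ 2 - 1) ^ 2 - 1) := by
    rw [← cos_two_mul, ← cos_two_mul, ← cos_pi_sub]
    ring_nf
  refine (mul_eq_zero.1 ?_).resolve_left (show cos (π / 7) + 1 ≠ 0 by positivity)
  linear_combination h₄ - h₃

theorem cos_pi_div_seven_mem_Icc : cos (π / 7) ∈ Set.Icc 0.900968867 0.900968868 := by
  have hlower : 0.86 < cos (π / 7) := by
    have h₁ : cos (π / 6) ≤ cos (π / 7) :=
      cos_le_cos_of_nonneg_of_le_pi (by positivity) (by linarith [pi_pos]) (by linarith [pi_pos])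
    have h₂ : 1.72 < √3 := lt_sqrt_of_sq_lt (by norm_num)
    rw [cos_pi_div_six] at h₁
    linarith
  have hcubic := cos_pi_div_seven_cubic
  set a := cos (π / 7)
  constructor <;> by_contra! h
  · nlinarith [mul_pos (sub_pos.2 h) (sub_pos.2 hlower),
      mul_pos (mul_pos (sub_pos.2 h) (sub_pos.2 hlower)) (sub_pos.2 hlower)]
  · nlinarith [mul_pos (sub_pos.2 h) (sub_pos.2 hlower),
      mul_pos (mul_pos (sub_pos.2 h) (sub_pos.2 hlower)) (sub_pos.2 hlower)]

theorem systole_ge : 3.9359 ≤ 8 * Real.arccosh (1 / 2 + cos (2 * π / 7)) := by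
  obtain ⟨h, -⟩ := cos_pi_div_seven_mem_Icc
  have hx : 1.12348979 ≤ 1 / 2 + cos (2 * π / 7) := by
    rw [show 2 * π / 7 = 2 * (π / 7) by ring, cos_two_mul]
    nlinarith
  have hexp : exp 0.4919875 ≤ 1.12348979 + 0.51208 := by
    refine (exp_bound' (n := 8) (by norm_num) (by norm_num) (by norm_num)).trans ?_
    norm_num [Finset.sum_range_succ, Nat.factorial]
  have := le_arccosh (x := 1 / 2 + cos (2 * π / 7)) (s := 0.51208) (t := 0.4919875)
    (by nlinarith) (by linarith)
  linarith

theorem second_length_mem_Icc :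
    6 * Real.arccosh (8 * cos (π / 7) ^ 4 - 6 * cos (π / 7) ^ 2 + 1) ∈
      Set.Icc 5.208 5.2081 := by
  obtain ⟨h, h'⟩ := cos_pi_div_seven_mem_Icc
  set a := cos (π / 7)
  have hsq : 0.900968867 ^ 2 ≤ a ^ 2 := by gcongr
  have hsq' : a ^ 2 ≤ 0.900968868 ^ 2 := by gcongr
  have hx : 1.4009688 ≤ 8 * a ^ 4 - 6 * a ^ 2 + 1 := by
    nlinarith [mul_nonneg (sub_nonneg.2 hsq) (sub_nonneg.2 hsq)]
  have hx' : 8 * a ^ 4 - 6 * a ^ 2 + 1 ≤ 1.4009689 := by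
    nlinarith [mul_nonneg (sub_nonneg.2 hsq) (sub_nonneg.2 hsq')]
  have hexp : exp 0.868 ≤ 1.4009688 + 0.98117965 := by
    refine (exp_bound' (n := 9) (by norm_num) (by norm_num) (by norm_num)).trans ?_
    norm_num [Finset.sum_range_succ, Nat.factorial]
  have hexp' : 1.4009689 + 0.98118 ≤ exp (5.2081 / 6) := by
    refine le_trans ?_ (sum_le_exp_of_nonneg (by norm_num) 9)
    norm_num [Finset.sum_range_succ, Nat.factorial]
  set x := 8 * a ^ 4 - 6 * a ^ 2 + 1
  constructor
  · have := le_arccosh (x := x) (s := 0.98117965) (t := 0.868) (by nlinarith) (by linarith)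
    linarith
  · have := arccosh_le (x := x) (s := 0.98118) (t := 5.2081 / 6) (by linarith) (by norm_num)
      (by nlinarith) (by linarith)
    linarith

theorem gaussPoly_testPoly_nonpos {x : ℝ} (hx : 3.9359 ≤ x) : gaussPoly testPoly x ≤ 0 :=
  mul_nonpos_of_nonpos_of_nonneg (testPoly_eval_nonpos (by nlinarith)) (exp_pos _).le

theorem mul_gaussPoly_testPoly_div_sinh_le {L : ℝ} (hL : 5.208 ≤ L) (hL' : L ≤ 5.2081) :
    28 * L * gaussPoly testPoly L / sinh (L / 2) ≤ -3300000000 := by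
  have hsinh : sinh (L / 2) ≤ exp (L / 2) / 2 := by
    rw [sinh_eq]
    linarith [exp_pos (-(L / 2))]
  have hexp : exp (L ^ 2 / 2 + L / 2) ≤ 10500000 := by
    have hsmall : exp 0.1663 ≤ 1.1812 := by
      refine (exp_bound' (n := 3) (by norm_num) (by norm_num) (by norm_num)).trans ?_
      norm_num [Finset.sum_range_succ, Nat.factorial]
    calc exp (L ^ 2 / 2 + L / 2) ≤ exp ((16 : ℕ) * 1 + 0.1663) :=
          exp_le_exp.2 (by push_cast; nlinarith)
      _ = exp 1 ^ 16 * exp 0.1663 := by rw [exp_add, exp_nat_mul]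
      _ ≤ 2.7182818286 ^ 16 * 1.1812 := by
          gcongr
          exact exp_one_lt_d9.le
      _ ≤ 10500000 := by norm_num
  have hsplit : exp (L / 2) = exp (L ^ 2 / 2 + L / 2) * exp (-L ^ 2 / 2) := by
    rw [← exp_add]
    ring_nf
  have hu : testPoly.eval (L ^ 2) ≤ -119 * 10 ^ 12 := testPoly_eval_le (by nlinarith)
  have hE : 0 < exp (-L ^ 2 / 2) := exp_pos _
  rw [div_le_iff₀ (sinh_pos_iff.2 (by linarith)), gaussPoly]
  calc 28 * L * (testPoly.eval (L ^ 2) * exp (-L ^ 2 / 2))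
      = L * testPoly.eval (L ^ 2) * (28 * exp (-L ^ 2 / 2)) := by ring
    _ ≤ 5.208 * (-119 * 10 ^ 12) * (28 * exp (-L ^ 2 / 2)) := by
        gcongr ?_ * _
        nlinarith
    _ ≤ -3300000000 * (10500000 * exp (-L ^ 2 / 2) / 2) := by linarith
    _ ≤ -3300000000 * sinh (L / 2) := by
        have := mul_le_mul_of_nonneg_right hexp hE.le
        linarith

theorem integral_gaussPoly_testPoly_mul_cosh_half :
    (1 / √(2 * π)) * ∫ x : ℝ, gaussPoly testPoly x * cosh (x / 2) =
      testPolyFT.eval (-1 / 4) * exp (1 / 8) := by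
  have h := integral_gaussPoly_mul_cosh_s4 testPoly_gaussMomentPoly (1 / 2)
  simp only [one_div_mul_eq_div] at h
  rw [h, one_div, inv_mul_cancel_left₀ (by positivity)]
  norm_num

theorem neg_testPolyFT_mul_exp_le : -(testPolyFT.eval (-1 / 4) * exp (1 / 8)) ≤ -5840000000 := by
  have hexp : 1.1328 ≤ exp (1 / 8) := by
    refine le_trans ?_ (sum_le_exp_of_nonneg (by norm_num) 3)
    norm_num [Finset.sum_range_succ, Nat.factorial]
  rw [testPolyFT_eval]
  norm_num
  linarith

theorem stmt_4 :
    ∃ (u : Polynomial ℝ) (c : ℝ), 0 < c ∧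
      (let f : ℝ → ℝ := gaussPoly u
      let fhat : ℝ → ℝ := evenFT f
      let L₁ : ℝ := 8 * Real.arccosh (1 / 2 + Real.cos (2 * π / 7))
      let L₂ : ℝ := 6 * Real.arccosh (8 * Real.cos (π / 7) ^ 4 - 6 * Real.cos (π / 7) ^ 2 + 1)
      (∀ x : ℝ, (3.9359 : ℝ) ≤ x → f x ≤ 0) ∧
      (∀ lam : ℝ, lam ∈ Set.Icc (2.575 : ℝ) 5.5 → fhat (Real.sqrt (lam - 1 / 4)) ≥ c) ∧
      (∀ lam : ℝ, (5.5 : ℝ) ≤ lam → fhat (Real.sqrt (lam - 1 / 4)) ≥ 0) ∧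
      (1 / c) *
          (4 * (∫ ξ in Set.Ioi (0 : ℝ), ξ * fhat ξ * Real.tanh (π * ξ))
            + (1 / Real.sqrt (2 * π)) * (21 * L₁ * f L₁ / Real.sinh (L₁ / 2) + 28 * L₂ * f L₂ / Real.sinh (L₂ / 2))
            - (1 / Real.sqrt (2 * π)) * ∫ x : ℝ, f x * Real.cosh (x / 2)) < 12) := by
  have hfhat : evenFT (gaussPoly testPoly) = gaussPoly testPolyFT :=
    funext (evenFT_gaussPoly_s4 testPoly_gaussMomentPoly)
  refine ⟨testPoly, 240000000, by norm_num, fun x hx => gaussPoly_testPoly_nonpos hx,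
    fun lam hlam => ?_, fun lam hlam => ?_, ?_⟩
  · obtain ⟨h, h'⟩ := hlam
    rw [hfhat, gaussPoly, neg_div, sq_sqrt (by linarith), ← neg_div]
    exact testPolyFT_mul_exp_ge (by linarith) (by linarith)
  · rw [hfhat]
    exact mul_nonneg (testPolyFT_eval_nonneg (sq_nonneg _)) (exp_pos _).le
  · rw [hfhat]
    obtain ⟨h₂, h₂'⟩ := second_length_mem_Icc
    have h₁ := systole_ge
    set L₁ := 8 * Real.arccosh (1 / 2 + cos (2 * π / 7))
    set L₂ := 6 * Real.arccosh (8 * cos (π / 7) ^ 4 - 6 * cos (π / 7) ^ 2 + 1)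
    have hL₁ : 21 * L₁ * gaussPoly testPoly L₁ / sinh (L₁ / 2) ≤ 0 :=
      div_nonpos_of_nonpos_of_nonneg
        (mul_nonpos_of_nonneg_of_nonpos (by linarith) (gaussPoly_testPoly_nonpos h₁))
        (sinh_nonneg_iff.2 (by linarith))
    have hL₂ := mul_gaussPoly_testPoly_div_sinh_le h₂ h₂'
    have hsqrt : √(2 * π) ≤ 2.507 :=
      (sqrt_le_left (by norm_num)).2 (by linarith [pi_lt_d4])
    have hgeom : (1 / √(2 * π)) * (21 * L₁ * gaussPoly testPoly L₁ / sinh (L₁ / 2)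
        + 28 * L₂ * gaussPoly testPoly L₂ / sinh (L₂ / 2)) ≤ -1310000000 := by
      rw [one_div_mul_eq_div, div_le_iff₀ (by positivity)]
      linarith
    rw [integral_gaussPoly_testPoly_mul_cosh_half]
    linarith [integral_Ioi_gaussPoly_testPolyFT_mul_tanh_le, neg_testPolyFT_mul_exp_le]
end
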